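/- arXiv:math/0408222 — 3 statements merged into one kernel-verified Lean document; each statement's English description precedes it below -/
import Mathlib

section
/- Let α be an irrational real number satisfying the Brjuno condition and set λ = e^{2πiα}. Then every holomorphic germ fixing 0 with multiplier λ is linearizable: for every function f holomorphic on a neighborhood of 0 ∈ ℂ with f(0) = 0 and f'(0) = λ, there exist r > 0 and an injective holomorphic map h on the disk {|z| < r} with h(0) = 0 and f(h(z)) = h(λz) for all |z| < r. -/
open Metric Set

/-- The denominators `q n` of the continued fraction expansion of `α`. -/
noncomputable def contFracDen (α : ℝ) (n : ℕ) : ℝ :=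
  (GenContFract.of α).dens n

/-- The Brjuno condition: `∑ (log q_{n+1}) / q_n < ∞`. -/
def BrjunoCondition (α : ℝ) : Prop :=
  Summable (fun n : ℕ => Real.log (contFracDen α (n + 1)) / contFracDen α n)

/-- `f` is linearizable at the fixed point `z₀` with multiplier `lam`: it is conformally
conjugate to the rotation `z ↦ lam * z` near `z₀`. -/
def LinearizableAt (f : ℂ → ℂ) (z₀ lam : ℂ) : Prop :=
  ∃ r > (0 : ℝ), ∃ h : ℂ → ℂ,
    DifferentiableOn ℂ h (ball (0 : ℂ) r) ∧ InjOn h (ball (0 : ℂ) r) ∧ h 0 = z₀ ∧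
    ∀ z ∈ ball (0 : ℂ) r, f (h z) = h (lam * z)

theorem bj_int (α : ℝ) (n : ℕ) : (∃ a b : ℤ, ((GenContFract.of α).contsAux n).a = a ∧
    ((GenContFract.of α).contsAux n).b = b) ∧ (∃ a b : ℤ, ((GenContFract.of α).contsAux (n+1)).a = a ∧
    ((GenContFract.of α).contsAux (n+1)).b = b) := by
  induction n with
  | zero =>
    refine ⟨⟨1, 0, by simp, by simp⟩, ⟨⌊α⌋, 1, ?_, by simp⟩⟩
    simp [GenContFract.of_h_eq_floor]
  | succ n ih =>
    refine ⟨ih.2, ?_⟩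
    obtain ⟨⟨a, b, ha, hb⟩, ⟨c, d, hc, hd⟩⟩ := ih
    rcases h : (GenContFract.of α).s.get? n with _ | gp
    · refine ⟨c, d, ?_⟩
      rw [GenContFract.contsAux_stable_step_of_terminated h]
      exact ⟨hc, hd⟩
    · obtain ⟨h1, z, hz⟩ := GenContFract.of_partNum_eq_one_and_exists_int_partDen_eq h
      rw [GenContFract.contsAux_recurrence h rfl rfl]
      refine ⟨z * c + a, z * d + b, ?_, ?_⟩
      · simp [h1, hz, ha, hc]
      · simp [h1, hz, hb, hd]

theorem bj_not_term (α : ℝ) (hα : Irrational α) (n : ℕ) :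
    ¬ (GenContFract.of α).TerminatedAt n := by
  intro h
  obtain ⟨q, hq⟩ := (GenContFract.terminates_iff_rat α).1 ⟨n, h⟩
  exact hα ⟨q, hq.symm⟩

theorem bj_dens_ge_fib (α : ℝ) (hα : Irrational α) (n : ℕ) :
    (Nat.fib (n+1) : ℝ) ≤ contFracDen α n :=
  GenContFract.succ_nth_fib_le_of_nth_den (Or.inr (bj_not_term α hα _))

theorem bj_dens_ge_one (α : ℝ) (hα : Irrational α) (n : ℕ) :
    (1 : ℝ) ≤ contFracDen α n :=
  le_trans (by exact_mod_cast Nat.fib_pos.2 (Nat.succ_pos n)) (bj_dens_ge_fib α hα n)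

theorem bj_dens_tendsto (α : ℝ) (hα : Irrational α) :
    Filter.Tendsto (contFracDen α) Filter.atTop Filter.atTop := by
  refine Filter.tendsto_atTop_mono (bj_dens_ge_fib α hα) ?_
  refine tendsto_natCast_atTop_atTop.comp ?_
  rw [← Filter.tendsto_add_atTop_iff_nat 1]
  exact Nat.fib_add_two_strictMono.tendsto_atTop

theorem bj_dist (α : ℝ) (hα : Irrational α) (n k : ℕ) (hk : 1 ≤ k)
    (hkq : (k : ℝ) < contFracDen α n) (m : ℤ) :
    1 / (contFracDen α n)^2 ≤ |k * α - m| := by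
  obtain ⟨p, q, hp, hq⟩ := (bj_int α n).2
  change (GenContFract.of α).nums n = p at hp
  have hq0 : contFracDen α n = q := hq
  obtain ⟨p', q', hp', hq'⟩ := (bj_int α (n+1)).2
  change (GenContFract.of α).nums (n+1) = p' at hp'
  have hq0' : contFracDen α (n+1) = q' := hq'
  have hdet : (GenContFract.of α).nums n * (GenContFract.of α).dens (n+1) -
      (GenContFract.of α).dens n * (GenContFract.of α).nums (n+1) = (-1)^(n+1) :=
    SimpContFract.determinant (s := SimpContFract.of α) (bj_not_term α hα n)
  have happ : |α - (GenContFract.of α).nums n / (GenContFract.of α).dens n| ≤ 1 / ((GenContFract.of α).dens n * ((GenContFract.of α).dens (n+1))) :=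
    GenContFract.abs_sub_convs_le (bj_not_term α hα n)
  change (GenContFract.of α).dens n = q at hq
  change (GenContFract.of α).dens (n+1) = q' at hq'
  have hmono : (GenContFract.of α).dens n ≤ (GenContFract.of α).dens (n+1) := GenContFract.of_den_mono
  rw [hp, hp', hq, hq'] at hdet
  rw [hp, hq, hq'] at happ
  rw [hq, hq'] at hmono
  have hq1 := bj_dens_ge_one α hα n
  rw [hq0] at hkq hq1 ⊢
  have hdetZ : p * q' - q * p' = (-1)^(n+1) := by exact_mod_cast hdet
  have hkqZ : (k : ℤ) < q := by exact_mod_cast hkq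
  have hcop : IsCoprime p q := by
    rcases neg_one_pow_eq_or ℤ (n+1) with h | h
    · exact ⟨q', -p', by rw [h] at hdetZ; linarith⟩
    · exact ⟨-q', p', by rw [h] at hdetZ; linarith⟩
  have hne : (k : ℤ) * p - m * q ≠ 0 := by
    intro h
    have : q ∣ k * p := ⟨m, by linarith⟩
    have : q ∣ k := hcop.symm.dvd_of_dvd_mul_right this
    have := Int.le_of_dvd (by omega) this
    omega
  have h1 : (1 : ℝ) ≤ |(k : ℝ) * p - m * q| := by exact_mod_cast Int.one_le_abs hne
  have hkq' : (k : ℝ) ≤ q - 1 := by exact_mod_cast (by omega : (k : ℤ) ≤ q - 1)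
  have hqpos : (0 : ℝ) < q := by linarith
  have hk0 : (0 : ℝ) ≤ k := by positivity
  have h2 : |(k : ℝ) * (α - p / q)| ≤ (q - 1) / q^2 := by
    rw [abs_mul, abs_of_nonneg hk0]
    have : 1 / ((q : ℝ) * q') ≤ 1 / q^2 := by
      apply one_div_le_one_div_of_le (by positivity)
      nlinarith
    calc (k : ℝ) * |α - p / q| ≤ (q - 1) * (1 / q^2) := by
          apply mul_le_mul hkq' (happ.trans this) (abs_nonneg _) (by linarith)
      _ = _ := by ring
  have h3 : 1 / (q : ℝ) ≤ |((k : ℝ) * p - m * q) / q| := by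
    rw [abs_div, abs_of_pos hqpos]
    gcongr
  have h4 : (k : ℝ) * α - m = k * (α - p / q) + (k * p - m * q) / q := by
    field_simp; ring
  have h5 : 1 / (q:ℝ)^2 = 1 / q - (q - 1) / q^2 := by field_simp; ring
  rw [h4, h5]
  have := abs_sub_abs_le_abs_sub (((k : ℝ) * p - m * q) / q) (-(k * (α - p / q)))
  rw [abs_neg, sub_neg_eq_add, add_comm] at this
  linarith

theorem bj_norm_lower (α : ℝ) (hα : Irrational α) (n k : ℕ) (hk : 1 ≤ k)
    (hkq : (k : ℝ) < contFracDen α n) :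
    2 * (1 / (contFracDen α n)^2) ≤ ‖Complex.exp (2 * Real.pi * Complex.I * α) ^ k - 1‖ := by
  have h := bj_dist α hα n k hk hkq (round (k * α))
  set y := (k : ℝ) * α - round (k * α) with hy
  have hy2 : |y| ≤ 1/2 := abs_sub_round _
  have e : Complex.exp (2 * Real.pi * Complex.I * α) ^ k = Complex.exp (Complex.I * ((2 * Real.pi * y : ℝ) : ℂ)) := by
    rw [← Complex.exp_nat_mul, Complex.exp_eq_exp_iff_exists_int]
    refine ⟨round (k * α), ?_⟩
    rw [hy]; push_cast; ring
  rw [e, Complex.norm_exp_I_mul_ofReal_sub_one]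
  have : 2 * Real.pi * y / 2 = Real.pi * y := by ring
  rw [this]
  have hs : 2 / Real.pi * |Real.pi * y| ≤ |Real.sin (Real.pi * y)| := by
    apply Real.mul_abs_le_abs_sin
    rw [abs_mul, abs_of_pos Real.pi_pos]
    nlinarith [Real.pi_pos]
  rw [abs_mul, abs_of_pos Real.pi_pos, ← mul_assoc, div_mul_cancel₀ _ Real.pi_pos.ne'] at hs
  rw [norm_mul]
  simp only [Real.norm_eq_abs]
  norm_num
  norm_num at h
  linarith [abs_nonneg y]

theorem bj_norm_pos (α : ℝ) (hα : Irrational α) (k : ℕ) (hk : 1 ≤ k) :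
    0 < ‖Complex.exp (2 * Real.pi * Complex.I * α) ^ k - 1‖ := by
  obtain ⟨n, hn⟩ := ((bj_dens_tendsto α hα).eventually_gt_atTop (k : ℝ)).exists
  refine lt_of_lt_of_le ?_ (bj_norm_lower α hα n k hk hn)
  have := bj_dens_ge_one α hα n
  positivity

theorem bj_count (B : Set ℕ) (q : ℝ) (hq : 1 ≤ q) (hB1 : ∀ j ∈ B, q ≤ j)
    (hB2 : ∀ i ∈ B, ∀ j ∈ B, i < j → q ≤ (j : ℝ) - i) :
    ∃ H : ℕ → ℝ, H 0 = 0 ∧ (∀ j, 0 ≤ H j) ∧ (∀ i j, i ≤ j → H i ≤ H j) ∧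
      (∀ i j, H i + H j ≤ H (i + j)) ∧ (∀ j, H j ≤ 2 * j) ∧
      (∀ j, j + 1 ∈ B → H j + q ≤ H (j + 1)) := by
  have huniq : ∀ (j : ℕ), ∀ b ∈ B, ∀ b' ∈ B, (b : ℝ) - q < j → j < b → (b' : ℝ) - q < j → j < b' →
      b = b' := by
    intro j b hb b' hb' h1 h2 h3 h4
    have h2' : (j : ℝ) < b := by exact_mod_cast h2
    have h4' : (j : ℝ) < b' := by exact_mod_cast h4
    rcases lt_trichotomy b b' with h | h | h
    · have := hB2 b hb b' hb' h; linarith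
    · exact h
    · have := hB2 b' hb' b hb h; linarith
  have hc : ∀ j : ℕ, ∃ c : ℝ, (∀ b ∈ B, (b : ℝ) - q < j → j < b → c = 2 * b - 2 * q) ∧
      ((¬ ∃ b ∈ B, (b : ℝ) - q < j ∧ j < b) → c = 2 * j - q) := by
    intro j
    by_cases h : ∃ b ∈ B, (b : ℝ) - q < j ∧ j < b
    · obtain ⟨b, hb, h1, h2⟩ := h
      refine ⟨2 * b - 2 * q, fun b' hb' h3 h4 => ?_, fun h => (h ⟨b, hb, h1, h2⟩).elim⟩
      rw [huniq j b hb b' hb' h1 h2 h3 h4]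
    · exact ⟨2 * j - q, fun b hb h1 h2 => (h ⟨b, hb, h1, h2⟩).elim, fun _ => rfl⟩
  choose c hc1 hc2 using hc
  obtain ⟨H, hH⟩ : ∃ H : ℕ → ℝ, ∀ j, H j = if (j : ℝ) < q then 0 else min (2 * j - q) (c j) :=
    ⟨_, fun _ => rfl⟩
  have hA : ∀ j : ℕ, (j : ℝ) < q → H j = 0 := fun j h => by rw [hH, if_pos h]
  have hBb : ∀ j : ℕ, q ≤ j → H j ≤ 2 * j - q := fun j h => by
    rw [hH, if_neg (not_lt.2 h)]; exact min_le_left _ _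
  have hC : ∀ j : ℕ, q ≤ j → ∀ b ∈ B, (b : ℝ) - q < j → j < b → H j ≤ 2 * b - 2 * q := by
    intro j h b hb h1 h2
    rw [hH, if_neg (not_lt.2 h), ← hc1 j b hb h1 h2]; exact min_le_right _ _
  have hE : ∀ (j : ℕ) (x : ℝ), q ≤ j → x ≤ 2 * j - q →
      (∀ b ∈ B, (b : ℝ) - q < j → j < b → x ≤ 2 * b - 2 * q) → x ≤ H j := by
    intro j x h h1 h2
    rw [hH, if_neg (not_lt.2 h)]
    refine le_min h1 ?_
    by_cases hh : ∃ b ∈ B, (b : ℝ) - q < j ∧ j < b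
    · obtain ⟨b, hb, h3, h4⟩ := hh
      rw [hc1 j b hb h3 h4]; exact h2 b hb h3 h4
    · rw [hc2 j hh]; exact h1
  have hnn : ∀ j, 0 ≤ H j := by
    intro j
    by_cases h : (j : ℝ) < q
    · rw [hA j h]
    · push Not at h
      refine hE j 0 h (by linarith) fun b hb h1 h2 => ?_
      have h2' : (j : ℝ) < b := by exact_mod_cast h2
      linarith
  have hmono : ∀ i j, i ≤ j → H i ≤ H j := by
    intro i j hij
    have hij' : (i : ℝ) ≤ j := by exact_mod_cast hij
    by_cases h : (i : ℝ) < q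
    · rw [hA i h]; exact hnn j
    · push Not at h
      have := hBb i h
      refine hE j _ (by linarith) (by linarith) fun b hb h1 h2 => ?_
      by_cases h3 : (b : ℝ) - q < i
      · exact hC i h b hb h3 (by omega)
      · push Not at h3; linarith
  refine ⟨H, hA 0 (by push_cast; linarith), hnn, hmono, ?_, ?_, ?_⟩
  · intro i j
    by_cases h : (i : ℝ) < q
    · rw [hA i h, zero_add]; exact hmono _ _ (by omega)
    by_cases h' : (j : ℝ) < q
    · rw [hA j h', add_zero]; exact hmono _ _ (by omega)
    push Not at h h'
    have h1 := hBb i h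
    have h2 := hBb j h'
    refine hE _ _ (by push_cast; linarith) (by push_cast; linarith) fun b hb h3 h4 => ?_
    have h4' : ((i + j : ℕ) : ℝ) < b := by exact_mod_cast h4
    push_cast at h4'
    linarith
  · intro j
    by_cases h : (j : ℝ) < q
    · rw [hA j h]; positivity
    · push Not at h
      have := hBb j h
      linarith
  · intro j hj
    have hj1 := hB1 _ hj
    refine hE _ _ hj1 ?_ ?_
    · push_cast at hj1 ⊢
      by_cases h : (j : ℝ) < q
      · rw [hA j h]; linarith
      · push Not at h
        by_cases hq2 : 1 < q
        · have := hC j h _ hj (by push_cast; linarith) (by omega)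
          push_cast at this
          linarith
        · have := hBb j h
          linarith
    · intro b hb h1 h2
      have := hB2 _ hj b hb h2
      linarith

theorem bj_davie (q : ℕ → ℝ) (hq : ∀ n, 1 ≤ q n) (hq0 : q 0 = 1)
    (hqt : Filter.Tendsto q Filter.atTop Filter.atTop)
    (hsum : Summable fun n : ℕ => Real.log (q (n + 1)) / q n)
    (lam : ℂ) (hnorm : ‖lam‖ = 1) (hpos : ∀ k : ℕ, 1 ≤ k → 0 < ‖lam ^ k - 1‖)
    (hlow : ∀ n k : ℕ, 1 ≤ k → (k : ℝ) < q n → 2 * (1 / (q n)^2) ≤ ‖lam ^ k - 1‖) :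
    ∃ (K : ℕ → ℝ) (C : ℝ), K 0 = 0 ∧ 0 ≤ C ∧ (∀ j, 0 ≤ K j) ∧ (∀ j, K j ≤ C * j) ∧
      (∀ i j, K i + K j ≤ K (i + j)) ∧
      (∀ j, K j - Real.log ‖lam ^ (j + 1) - 1‖ ≤ K (j + 1)) := by
  have hex : ∀ n, ∃ H : ℕ → ℝ, H 0 = 0 ∧ (∀ j, 0 ≤ H j) ∧ (∀ i j, i ≤ j → H i ≤ H j) ∧
      (∀ i j, H i + H j ≤ H (i + j)) ∧ (∀ j, H j ≤ 2 * j) ∧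
      (∀ j, ‖lam ^ (j + 1) - 1‖ < 1 / (q n)^2 → H j + q n ≤ H (j + 1)) := by
    intro n
    have hθ : 0 < 1 / (q n)^2 := by have := hq n; positivity
    obtain ⟨H, h1, h2, h3, h4, h5, h6⟩ := bj_count {j : ℕ | 1 ≤ j ∧ ‖lam ^ j - 1‖ < 1 / (q n)^2}
      (q n) (hq n) (by
        rintro j ⟨hj1, hj2⟩
        by_contra! h
        have := hlow n j hj1 h
        linarith) (by
        rintro i ⟨hi1, hi2⟩ j ⟨hj1, hj2⟩ hij
        by_contra! h
        have h' : ((j - i : ℕ) : ℝ) < q n := by rw [Nat.cast_sub hij.le]; exact h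
        have h2 := hlow n (j - i) (by omega) h'
        have h3 : lam ^ i * (lam ^ (j - i) - 1) = (lam ^ j - 1) - (lam ^ i - 1) := by
          rw [mul_sub, ← pow_add, Nat.add_sub_cancel' hij.le]; ring
        have h4 : ‖lam ^ (j - i) - 1‖ = ‖(lam ^ j - 1) - (lam ^ i - 1)‖ := by
          rw [← h3, norm_mul, norm_pow, hnorm, one_pow, one_mul]
        have h5 := norm_sub_le (lam ^ j - 1) (lam ^ i - 1)
        linarith)
    exact ⟨H, h1, h2, h3, h4, h5, fun j hj => h6 j ⟨by omega, hj⟩⟩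
  choose H h1 h2 h3 h4 h5 h6 using hex
  have hL : ∀ n, 0 ≤ Real.log (q (n + 1)) / q n := fun n =>
    div_nonneg (Real.log_nonneg (hq _)) (by linarith [hq n])
  have hS : ∀ j, Summable fun n => 2 * (Real.log (q (n + 1)) / q n) * H n j := by
    intro j
    refine Summable.of_nonneg_of_le (fun n => mul_nonneg (mul_nonneg (by norm_num) (hL n)) (h2 n j))
      (fun n => mul_le_mul_of_nonneg_left (h5 n j) (mul_nonneg (by norm_num) (hL n))) ?_
    exact (hsum.mul_left 2).mul_right _
  refine ⟨fun j => ∑' n, 2 * (Real.log (q (n + 1)) / q n) * H n j,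
    (∑' n, 2 * (Real.log (q (n + 1)) / q n)) * 2, ?_, ?_, ?_, ?_, ?_, ?_⟩
  · simp [h1]
  · exact mul_nonneg (tsum_nonneg fun n => mul_nonneg (by norm_num) (hL n)) (by norm_num)
  · exact fun j => tsum_nonneg fun n => mul_nonneg (mul_nonneg (by norm_num) (hL n)) (h2 n j)
  · intro j
    rw [mul_assoc, ← tsum_mul_right]
    exact (hS j).tsum_le_tsum (fun n => mul_le_mul_of_nonneg_left (h5 n j) (mul_nonneg (by norm_num) (hL n)))
      ((hsum.mul_left 2).mul_right _)
  · intro i j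
    simp only
    rw [← (hS i).tsum_add (hS j)]
    refine ((hS i).add (hS j)).tsum_le_tsum (fun n => ?_) (hS _)
    rw [← mul_add]
    exact mul_le_mul_of_nonneg_left (h4 n i j) (mul_nonneg (by norm_num) (hL n))
  · intro j
    simp only
    set x := ‖lam ^ (j + 1) - 1‖ with hx
    have hxpos : 0 < x := hpos _ (by omega)
    have hmon : ∀ n, 2 * (Real.log (q (n + 1)) / q n) * H n j ≤ 2 * (Real.log (q (n + 1)) / q n) * H n (j + 1) :=
      fun n => mul_le_mul_of_nonneg_left (h3 n _ _ (by omega)) (mul_nonneg (by norm_num) (hL n))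
    by_cases hx1 : 1 ≤ x
    · have := Real.log_nonneg hx1
      have := (hS j).tsum_le_tsum hmon (hS (j + 1))
      linarith
    push Not at hx1
    have hexn : ∃ n, 1 / (q n)^2 ≤ x := by
      obtain ⟨n, hn⟩ := (hqt.eventually_ge_atTop (1 / x)).exists
      refine ⟨n, ?_⟩
      have := hq n
      rw [div_le_iff₀ (by positivity)]
      rw [div_le_iff₀ hxpos] at hn
      nlinarith
    classical
    have hn0 : Nat.find hexn ≠ 0 := by
      intro h0
      have := Nat.find_spec hexn
      rw [h0, hq0] at this
      norm_num at this
      linarith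
    obtain ⟨ν, hν⟩ := Nat.exists_eq_succ_of_ne_zero hn0
    have hs := Nat.find_spec hexn
    rw [hν] at hs
    have hm := Nat.find_min hexn (m := ν) (by omega)
    push Not at hm
    have hinc := h6 ν j hm
    have hlog : - Real.log x ≤ 2 * Real.log (q (ν + 1)) := by
      have := Real.log_le_log (by have := hq (ν + 1); positivity) hs
      rw [one_div, Real.log_inv, Real.log_pow] at this
      push_cast at this
      linarith
    have hd : 2 * (Real.log (q (ν + 1)) / q ν) * H ν (j + 1) - 2 * (Real.log (q (ν + 1)) / q ν) * H ν j ≤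
        ∑' n, (2 * (Real.log (q (n + 1)) / q n) * H n (j + 1) - 2 * (Real.log (q (n + 1)) / q n) * H n j) :=
      ((hS (j+1)).sub (hS j)).le_tsum ν (fun n _ => sub_nonneg.2 (hmon n))
    rw [(hS (j+1)).tsum_sub (hS j)] at hd
    have hqν := hq ν
    have : 2 * Real.log (q (ν + 1)) = 2 * (Real.log (q (ν + 1)) / q ν) * q ν := by
      field_simp
    have h7 := mul_le_mul_of_nonneg_left hinc (mul_nonneg (by norm_num : (0:ℝ) ≤ 2) (hL ν))
    linarith

/-- Weighted `ℓ¹` norm of a formal power series. -/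
noncomputable def bjNorm (v : ℕ → ENNReal) (p : PowerSeries ℂ) : ENNReal :=
  ∑' n, ‖PowerSeries.coeff n p‖ₑ * v n

theorem bjNorm_mul (v : ℕ → ENNReal) (hv : ∀ a b, v (a + b) ≤ v a * v b) (p r : PowerSeries ℂ) :
    bjNorm v (p * r) ≤ bjNorm v p * bjNorm v r := by
  unfold bjNorm
  have e : (∑' n, ‖PowerSeries.coeff n p‖ₑ * v n) * (∑' n, ‖PowerSeries.coeff n r‖ₑ * v n) =
      ∑' n : ℕ, ∑ x ∈ Finset.HasAntidiagonal.antidiagonal n, (‖PowerSeries.coeff x.1 p‖ₑ * v x.1) *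
        (‖PowerSeries.coeff x.2 r‖ₑ * v x.2) := by
    rw [← ENNReal.tsum_mul_right]
    simp_rw [← ENNReal.tsum_mul_left]
    rw [← ENNReal.tsum_prod (f := fun a b => ‖PowerSeries.coeff a p‖ₑ * v a *
        (‖PowerSeries.coeff b r‖ₑ * v b)),
      ← (Finset.HasAntidiagonal.sigmaAntidiagonalEquivProd (A := ℕ)).tsum_eq, ENNReal.tsum_sigma']
    refine tsum_congr fun n => ?_
    rw [tsum_fintype]
    exact Finset.sum_coe_sort (Finset.HasAntidiagonal.antidiagonal n) (fun x : ℕ × ℕ => (‖PowerSeries.coeff x.1 p‖ₑ * v x.1) *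
        (‖PowerSeries.coeff x.2 r‖ₑ * v x.2))
  rw [e]
  refine ENNReal.tsum_le_tsum fun n => ?_
  rw [PowerSeries.coeff_mul]
  calc _ ≤ (∑ x ∈ Finset.HasAntidiagonal.antidiagonal n, ‖PowerSeries.coeff x.1 p * PowerSeries.coeff x.2 r‖ₑ) * v n := by
        gcongr
        exact enorm_sum_le _ _
    _ = ∑ x ∈ Finset.HasAntidiagonal.antidiagonal n, ‖PowerSeries.coeff x.1 p * PowerSeries.coeff x.2 r‖ₑ * v n := by
        rw [Finset.sum_mul]
    _ ≤ _ := by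
        refine Finset.sum_le_sum fun x hx => ?_
        rw [Finset.HasAntidiagonal.mem_antidiagonal] at hx
        rw [← hx, enorm_mul]
        calc _ ≤ ‖PowerSeries.coeff x.1 p‖ₑ * ‖PowerSeries.coeff x.2 r‖ₑ * (v x.1 * v x.2) := by
              gcongr; exact hv _ _
          _ = _ := by ring

theorem bjNorm_one (v : ℕ → ENNReal) (hv0 : v 0 ≤ 1) : bjNorm v 1 ≤ 1 := by
  unfold bjNorm
  rw [tsum_eq_single 0]
  · simpa using hv0
  · intro n hn
    simp [PowerSeries.coeff_one, hn]

theorem bjNorm_X (v : ℕ → ENNReal) (hv1 : v 1 ≤ 1) : bjNorm v PowerSeries.X ≤ 1 := by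
  unfold bjNorm
  rw [tsum_eq_single 1]
  · simpa using hv1
  · intro n hn
    simp [PowerSeries.coeff_X, hn]

theorem bjNorm_pow (v : ℕ → ENNReal) (hv : ∀ a b, v (a + b) ≤ v a * v b) (hv0 : v 0 ≤ 1)
    (p : PowerSeries ℂ) (k : ℕ) : bjNorm v (p ^ k) ≤ bjNorm v p ^ k := by
  induction k with
  | zero => simpa using bjNorm_one v hv0
  | succ k ih =>
    rw [pow_succ, pow_succ]
    exact (bjNorm_mul v hv _ _).trans (by gcongr)

theorem bjNorm_term (v : ℕ → ENNReal) (hv : ∀ a b, v (a + b) ≤ v a * v b) (hv0 : v 0 ≤ 1)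
    (hv1 : v 1 ≤ 1) (u : PowerSeries ℂ) (k : ℕ) :
    bjNorm v (PowerSeries.X ^ k * u ^ (k + 2)) ≤ bjNorm v u ^ (k + 2) := by
  calc _ ≤ bjNorm v (PowerSeries.X ^ k) * bjNorm v (u ^ (k + 2)) := bjNorm_mul v hv _ _
    _ ≤ 1 * bjNorm v u ^ (k + 2) := by
      gcongr
      · exact (bjNorm_pow v hv hv0 _ _).trans (pow_le_one' (bjNorm_X v hv1) _)
      · exact bjNorm_pow v hv hv0 _ _
    _ = _ := one_mul _

/-- The formal series `∑ g_k X^k u^(k+2)`. -/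
noncomputable def bjW (g : ℕ → ℂ) (u : PowerSeries ℂ) : PowerSeries ℂ :=
  PowerSeries.mk fun n => ∑ k ∈ Finset.range (n + 1),
    g k * PowerSeries.coeff n (PowerSeries.X ^ k * u ^ (k + 2))

theorem bj_coeff_zero (u : PowerSeries ℂ) (k n : ℕ) (h : n < k) :
    PowerSeries.coeff n (PowerSeries.X ^ k * u) = 0 := by
  exact PowerSeries.X_pow_dvd_iff.1 (dvd_mul_right _ _) n h

theorem bjNorm_W (v : ℕ → ENNReal) (hv : ∀ a b, v (a + b) ≤ v a * v b) (hv0 : v 0 ≤ 1)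
    (hv1 : v 1 ≤ 1) (g : ℕ → ℂ) (u : PowerSeries ℂ) :
    bjNorm v (bjW g u) ≤ ∑' k, ‖g k‖ₑ * bjNorm v u ^ (k + 2) := by
  calc bjNorm v (bjW g u) ≤ ∑' n, ∑' k, ‖g k‖ₑ *
        (‖PowerSeries.coeff n (PowerSeries.X ^ k * u ^ (k + 2))‖ₑ * v n) := by
        refine ENNReal.tsum_le_tsum fun n => ?_
        rw [bjW, PowerSeries.coeff_mk]
        calc _ ≤ (∑ k ∈ Finset.range (n + 1),
              ‖g k * PowerSeries.coeff n (PowerSeries.X ^ k * u ^ (k + 2))‖ₑ) * v n := by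
              gcongr; exact enorm_sum_le _ _
          _ = ∑ k ∈ Finset.range (n + 1), ‖g k‖ₑ *
              (‖PowerSeries.coeff n (PowerSeries.X ^ k * u ^ (k + 2))‖ₑ * v n) := by
              rw [Finset.sum_mul]
              refine Finset.sum_congr rfl fun k _ => ?_
              rw [enorm_mul, mul_assoc]
          _ ≤ _ := ENNReal.sum_le_tsum _
    _ = ∑' k, ‖g k‖ₑ * bjNorm v (PowerSeries.X ^ k * u ^ (k + 2)) := by
        rw [ENNReal.tsum_comm]
        simp_rw [ENNReal.tsum_mul_left]
        rfl
    _ ≤ _ := by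
        refine ENNReal.tsum_le_tsum fun k => ?_
        gcongr
        exact bjNorm_term v hv hv0 hv1 u k

/-- The fixed point operator. -/
noncomputable def bjPhi (lam : ℂ) (g : ℕ → ℂ) (u : PowerSeries ℂ) : PowerSeries ℂ :=
  PowerSeries.mk fun n => Nat.casesOn n 1
    (fun j => PowerSeries.coeff j (bjW g u) / (lam * (lam ^ (j + 1) - 1)))

theorem bjW_congr (g : ℕ → ℂ) (u u' : PowerSeries ℂ) (n : ℕ) (h : PowerSeries.X ^ n ∣ u - u') :
    PowerSeries.X ^ n ∣ bjW g u - bjW g u' := by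
  rw [PowerSeries.X_pow_dvd_iff]
  intro m hm
  rw [map_sub, bjW, bjW, PowerSeries.coeff_mk, PowerSeries.coeff_mk, ← Finset.sum_sub_distrib]
  refine Finset.sum_eq_zero fun k _ => ?_
  rw [← mul_sub, ← map_sub, ← mul_sub]
  have : PowerSeries.X ^ n ∣ PowerSeries.X ^ k * (u ^ (k + 2) - u' ^ (k + 2)) :=
    Dvd.dvd.mul_left (h.trans (sub_dvd_pow_sub_pow _ _ _)) _
  rw [PowerSeries.X_pow_dvd_iff.1 this m hm, mul_zero]

theorem bjPhi_congr (lam : ℂ) (g : ℕ → ℂ) (u u' : PowerSeries ℂ) (n : ℕ)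
    (h : PowerSeries.X ^ n ∣ u - u') :
    PowerSeries.X ^ (n + 1) ∣ bjPhi lam g u - bjPhi lam g u' := by
  rw [PowerSeries.X_pow_dvd_iff]
  intro m hm
  rw [map_sub, bjPhi, bjPhi, PowerSeries.coeff_mk, PowerSeries.coeff_mk]
  cases m with
  | zero => simp
  | succ m =>
    have := PowerSeries.X_pow_dvd_iff.1 (bjW_congr g u u' n h) m (by omega)
    rw [map_sub, sub_eq_zero] at this
    simp [this]

theorem bjNorm_Phi (v : ℕ → ENNReal) (hv : ∀ a b, v (a + b) ≤ v a * v b) (hv0 : v 0 ≤ 1)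
    (hv1 : v 1 ≤ 1) (lam : ℂ)
    (hd : ∀ j, ‖(lam * (lam ^ (j + 1) - 1))⁻¹‖ₑ * v (j + 1) ≤ v j)
    (g : ℕ → ℂ) (hg : ∑' k, ‖g k‖ₑ * 2 ^ (k + 2) ≤ 1) (u : PowerSeries ℂ) (hu : bjNorm v u ≤ 2) :
    bjNorm v (bjPhi lam g u) ≤ 2 := by
  have h1 : bjNorm v (bjW g u) ≤ 1 := by
    refine (bjNorm_W v hv hv0 hv1 g u).trans (le_trans ?_ hg)
    refine ENNReal.tsum_le_tsum fun k => ?_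
    gcongr
  rw [bjNorm, tsum_eq_zero_add' ENNReal.summable]
  calc _ ≤ (1 : ENNReal) + bjNorm v (bjW g u) := by
        gcongr
        · simpa [bjPhi] using hv0
        · refine ENNReal.tsum_le_tsum fun j => ?_
          rw [bjPhi, PowerSeries.coeff_mk]
          simp only
          rw [div_eq_mul_inv, enorm_mul, mul_assoc]
          gcongr
          exact hd j
    _ ≤ 1 + 1 := by gcongr
    _ = 2 := one_add_one_eq_two

theorem bj_formal (v : ℕ → ENNReal) (hv : ∀ a b, v (a + b) ≤ v a * v b) (hv0 : v 0 ≤ 1)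
    (hv1 : v 1 ≤ 1) (lam : ℂ) (hlam : ∀ j : ℕ, lam * (lam ^ (j + 1) - 1) ≠ 0)
    (hd : ∀ j, ‖(lam * (lam ^ (j + 1) - 1))⁻¹‖ₑ * v (j + 1) ≤ v j)
    (g : ℕ → ℂ) (hg : ∑' k, ‖g k‖ₑ * 2 ^ (k + 2) ≤ 1) :
    ∃ u : PowerSeries ℂ, PowerSeries.coeff 0 u = 1 ∧ bjNorm v u ≤ 2 ∧
      ∀ j, lam * (lam ^ (j + 1) - 1) * PowerSeries.coeff (j + 1) u = PowerSeries.coeff j (bjW g u) := by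
  obtain ⟨s, hs0, hs⟩ : ∃ s : ℕ → PowerSeries ℂ, s 0 = 1 ∧ ∀ n, s (n + 1) = bjPhi lam g (s n) :=
    ⟨fun n => (bjPhi lam g)^[n] 1, rfl, fun n => Function.iterate_succ_apply' _ _ _⟩
  have hnorm : ∀ n, bjNorm v (s n) ≤ 2 := by
    intro n
    induction n with
    | zero => rw [hs0]; exact (bjNorm_one v hv0).trans (by norm_num)
    | succ n ih => rw [hs]; exact bjNorm_Phi v hv hv0 hv1 lam hd g hg _ ih
  have hstep : ∀ n, PowerSeries.X ^ n ∣ s (n + 1) - s n := by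
    intro n
    induction n with
    | zero => simp
    | succ n ih => have := bjPhi_congr lam g _ _ n ih; rwa [← hs, ← hs] at this
  have hcoeff : ∀ j m, j < m → PowerSeries.coeff j (s m) = PowerSeries.coeff j (s (j + 1)) := by
    intro j m hm
    induction m, hm using Nat.le_induction with
    | base => rfl
    | succ m hm ih =>
      rw [← ih]
      have := PowerSeries.X_pow_dvd_iff.1 (hstep m) j (by omega)
      rwa [map_sub, sub_eq_zero] at this
  obtain ⟨u, hu⟩ : ∃ u : PowerSeries ℂ, ∀ j, PowerSeries.coeff j u = PowerSeries.coeff j (s (j + 1)) :=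
    ⟨PowerSeries.mk fun j => PowerSeries.coeff j (s (j + 1)), fun j => PowerSeries.coeff_mk _ _⟩
  have hdvd : ∀ m, PowerSeries.X ^ m ∣ s m - u := by
    intro m
    rw [PowerSeries.X_pow_dvd_iff]
    intro j hj
    rw [map_sub, hu, hcoeff j m hj, sub_self]
  refine ⟨u, ?_, ?_, ?_⟩
  · rw [hu, hs, bjPhi, PowerSeries.coeff_mk]; rfl
  · unfold bjNorm
    rw [ENNReal.tsum_eq_iSup_nat]
    refine iSup_le fun m => ?_
    refine le_trans ?_ (hnorm m)
    refine le_trans (le_of_eq ?_) (ENNReal.sum_le_tsum (Finset.range m))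
    refine Finset.sum_congr rfl fun j hj => ?_
    rw [Finset.mem_range] at hj
    rw [hu, hcoeff j m hj]
  · intro j
    rw [hu, hs, bjPhi, PowerSeries.coeff_mk]
    simp only
    rw [mul_div_cancel₀ _ (hlam j)]
    have := PowerSeries.X_pow_dvd_iff.1 (bjW_congr g _ _ _ (hdvd (j + 1))) j (by omega)
    rwa [map_sub, sub_eq_zero] at this

/-- Evaluation of a power series. -/
noncomputable def bjEv (z : ℂ) (p : PowerSeries ℂ) : ℂ := ∑' n, PowerSeries.coeff n p * z ^ n

theorem bj_ev_le (v : ℕ → ENNReal) (z : ℂ) (hz : ∀ n, ‖z‖ₑ ^ n ≤ v n) (p : PowerSeries ℂ) :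
    ∑' n, ‖PowerSeries.coeff n p * z ^ n‖ₑ ≤ bjNorm v p := by
  refine ENNReal.tsum_le_tsum fun n => ?_
  rw [enorm_mul, enorm_pow]
  gcongr
  exact hz n

theorem bj_ev_summable (v : ℕ → ENNReal) (z : ℂ) (hz : ∀ n, ‖z‖ₑ ^ n ≤ v n) (p : PowerSeries ℂ)
    (hp : bjNorm v p ≠ ⊤) : Summable fun n => ‖PowerSeries.coeff n p * z ^ n‖ :=
  tsum_enorm_ne_top_iff_summable_norm.1 (ne_top_of_le_ne_top hp (bj_ev_le v z hz p))

theorem bj_ev_mul (v : ℕ → ENNReal) (z : ℂ) (hz : ∀ n, ‖z‖ₑ ^ n ≤ v n) (p r : PowerSeries ℂ)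
    (hp : bjNorm v p ≠ ⊤) (hr : bjNorm v r ≠ ⊤) : bjEv z (p * r) = bjEv z p * bjEv z r := by
  unfold bjEv
  rw [tsum_mul_tsum_eq_tsum_sum_antidiagonal_of_summable_norm (bj_ev_summable v z hz p hp)
    (bj_ev_summable v z hz r hr)]
  refine tsum_congr fun n => ?_
  rw [PowerSeries.coeff_mul, Finset.sum_mul]
  refine Finset.sum_congr rfl fun x hx => ?_
  rw [Finset.HasAntidiagonal.mem_antidiagonal] at hx
  rw [← hx, pow_add]; ring

theorem bj_ev_pow (v : ℕ → ENNReal) (hv : ∀ a b, v (a + b) ≤ v a * v b) (hv0 : v 0 ≤ 1)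
    (z : ℂ) (hz : ∀ n, ‖z‖ₑ ^ n ≤ v n) (p : PowerSeries ℂ)
    (hp : bjNorm v p ≠ ⊤) (k : ℕ) : bjEv z (p ^ k) = bjEv z p ^ k := by
  induction k with
  | zero =>
    rw [pow_zero, pow_zero, bjEv, tsum_eq_single 0]
    · simp
    · intro n hn
      simp [PowerSeries.coeff_one, hn]
  | succ k ih =>
    rw [pow_succ, pow_succ, bj_ev_mul v z hz _ _ _ hp, ih]
    exact ne_top_of_le_ne_top (ENNReal.pow_ne_top hp) (bjNorm_pow v hv hv0 p k)

theorem bj_ev_X (z : ℂ) : bjEv z PowerSeries.X = z := by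
  rw [bjEv, tsum_eq_single 1]
  · simp
  · intro n hn
    simp [PowerSeries.coeff_X, hn]

theorem bj_ev_W (v : ℕ → ENNReal) (hv : ∀ a b, v (a + b) ≤ v a * v b) (hv0 : v 0 ≤ 1)
    (hv1 : v 1 ≤ 1) (z : ℂ) (hz : ∀ n, ‖z‖ₑ ^ n ≤ v n)
    (g : ℕ → ℂ) (hg : ∑' k, ‖g k‖ₑ * 2 ^ (k + 2) ≤ 1) (u : PowerSeries ℂ) (hu : bjNorm v u ≤ 2) :
    bjEv z (bjW g u) = ∑' k, g k * (z ^ k * bjEv z u ^ (k + 2)) := by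
  have hX : bjNorm v PowerSeries.X ≠ ⊤ := ne_top_of_le_ne_top (by simp) (bjNorm_X v hv1)
  have hu' : bjNorm v u ≠ ⊤ := ne_top_of_le_ne_top (by simp) hu
  have hpow : ∀ (p : PowerSeries ℂ) (k : ℕ), bjNorm v p ≠ ⊤ → bjNorm v (p ^ k) ≠ ⊤ := fun p k hp =>
    ne_top_of_le_ne_top (ENNReal.pow_ne_top hp) (bjNorm_pow v hv hv0 p k)
  have hterm : ∀ k, z ^ k * bjEv z u ^ (k + 2) = bjEv z (PowerSeries.X ^ k * u ^ (k + 2)) := by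
    intro k
    rw [bj_ev_mul v z hz _ _ (hpow _ _ hX) (hpow _ _ hu'), bj_ev_pow v hv hv0 z hz _ hX,
      bj_ev_pow v hv hv0 z hz _ hu', bj_ev_X]
  have hsum : Summable (Function.uncurry fun k n : ℕ => g k *
      (PowerSeries.coeff n (PowerSeries.X ^ k * u ^ (k + 2)) * z ^ n)) := by
    refine Summable.of_enorm (ne_top_of_le_ne_top (b := 1) (by simp) ?_)
    rw [ENNReal.tsum_prod']
    refine le_trans ?_ hg
    refine ENNReal.tsum_le_tsum fun k => ?_
    simp only [Function.uncurry]
    simp_rw [enorm_mul (g k)]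
    rw [ENNReal.tsum_mul_left]
    gcongr
    refine (bj_ev_le v z hz _).trans ((bjNorm_term v hv hv0 hv1 u k).trans ?_)
    gcongr
  simp_rw [hterm]
  have : ∀ k, g k * bjEv z (PowerSeries.X ^ k * u ^ (k + 2)) = ∑' n, g k *
      (PowerSeries.coeff n (PowerSeries.X ^ k * u ^ (k + 2)) * z ^ n) := by
    intro k; rw [bjEv, tsum_mul_left]
  simp_rw [this]
  rw [← hsum.tsum_comm, bjEv]
  refine tsum_congr fun n => ?_
  rw [bjW, PowerSeries.coeff_mk, Finset.sum_mul, tsum_eq_sum (s := Finset.range (n + 1))]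
  · exact Finset.sum_congr rfl fun k _ => by ring
  · intro k hk
    rw [Finset.mem_range, not_lt] at hk
    rw [bj_coeff_zero _ _ _ (by omega)]; simp

theorem bj_expand (lam : ℂ) (f : ℂ → ℂ) (U : Set ℂ) (hU : IsOpen U) (h0U : (0 : ℂ) ∈ U)
    (hf : DifferentiableOn ℂ f U) (hf0 : f 0 = 0) (hfd : deriv f 0 = lam) :
    ∃ (ρ : ℝ) (a : ℕ → ℂ), 0 < ρ ∧ (Summable fun k => ‖a (k + 2)‖ * ρ ^ (k + 2)) ∧
      ∀ y : ℂ, ‖y‖ ≤ ρ → f y = lam * y + ∑' k, a (k + 2) * y ^ (k + 2) := by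
  obtain ⟨R, hR, hRU⟩ := Metric.nhds_basis_closedBall.mem_iff.1 (hU.mem_nhds h0U)
  lift R to NNReal using hR.le
  have hR' : 0 < R := by exact_mod_cast hR
  have hp := (hf.mono hRU).hasFPowerSeriesOnBall hR'
  set p := cauchyPowerSeries f 0 R
  have hs : ∀ y : ℂ, ‖y‖ < R → HasSum (fun n => p.coeff n * y ^ n) (f y) := by
    intro y hy
    have := hp.hasSum (y := y) (by simpa [Metric.mem_eball, edist_zero_right, enorm_eq_nnnorm] using hy)
    simpa [mul_comm] using this
  have h0 : p.coeff 0 = 0 := by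
    rw [← hf0]; exact hp.hasFPowerSeriesAt.coeff_zero _
  have h1 : p.coeff 1 = lam := by
    rw [← hfd, hp.hasFPowerSeriesAt.deriv]; rfl
  refine ⟨R / 2, p.coeff, by positivity, ?_, ?_⟩
  · have hn : ‖(((R : ℝ) / 2 : ℝ) : ℂ)‖ = (R : ℝ) / 2 := by
      rw [Complex.norm_real, Real.norm_of_nonneg (by positivity)]
    have := (hs (((R : ℝ) / 2 : ℝ) : ℂ) (by rw [hn]; linarith)).summable.norm
    have := (summable_nat_add_iff 2).2 this
    refine this.congr fun k => ?_
    rw [norm_mul, norm_pow, hn]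
  · intro y hy
    have hh := hs y (by linarith)
    rw [← hh.tsum_eq, ← hh.summable.sum_add_tsum_nat_add 2]
    simp [Finset.sum_range_succ, h0, h1]

theorem bj_main (lam : ℂ) (hnorm : ‖lam‖ = 1) (hpos : ∀ k : ℕ, 1 ≤ k → 0 < ‖lam ^ k - 1‖)
    (K : ℕ → ℝ) (C : ℝ) (hK0 : K 0 = 0) (hC : 0 ≤ C) (hKnn : ∀ j, 0 ≤ K j) (hKC : ∀ j, K j ≤ C * j)
    (hKadd : ∀ i j, K i + K j ≤ K (i + j))
    (hKd : ∀ j, K j - Real.log ‖lam ^ (j + 1) - 1‖ ≤ K (j + 1))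
    (f : ℂ → ℂ) (ρ : ℝ) (a : ℕ → ℂ) (hρ : 0 < ρ) (ha : Summable fun k => ‖a (k + 2)‖ * ρ ^ (k + 2))
    (hf : ∀ y : ℂ, ‖y‖ ≤ ρ → f y = lam * y + ∑' k, a (k + 2) * y ^ (k + 2)) :
    ∃ r > (0 : ℝ), ∃ h : ℂ → ℂ,
      DifferentiableOn ℂ h (ball (0 : ℂ) r) ∧ InjOn h (ball (0 : ℂ) r) ∧ h 0 = 0 ∧
      ∀ z ∈ ball (0 : ℂ) r, f (h z) = h (lam * z) := by
  -- choice of the scaling parameter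
  set M := ∑' k, ‖a (k + 2)‖ * ρ ^ (k + 2) with hM
  have hM0 : 0 ≤ M := tsum_nonneg fun k => by positivity
  obtain ⟨t, ht0, ht1, ht2⟩ : ∃ t : ℝ, 0 < t ∧ 2 * t ≤ ρ ∧ 4 * t / ρ ^ 2 * M ≤ 1 := by
    refine ⟨min (ρ / 2) (ρ ^ 2 / (4 * (M + 1))), by positivity, ?_, ?_⟩
    · linarith [min_le_left (ρ / 2) (ρ ^ 2 / (4 * (M + 1)))]
    · have := min_le_right (ρ / 2) (ρ ^ 2 / (4 * (M + 1)))
      calc _ ≤ 4 * (ρ ^ 2 / (4 * (M + 1))) / ρ ^ 2 * M := by gcongr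
        _ = M / (M + 1) := by field_simp
        _ ≤ 1 := by rw [div_le_one (by positivity)]; linarith
  obtain ⟨g, hg⟩ : ∃ g : ℕ → ℂ, ∀ k, g k = a (k + 2) * (t : ℂ) ^ (k + 1) := ⟨_, fun _ => rfl⟩
  have hgs : ∑' k, ‖g k‖ₑ * 2 ^ (k + 2) ≤ 1 := by
    calc ∑' k, ‖g k‖ₑ * 2 ^ (k + 2)
        ≤ ∑' k, ENNReal.ofReal (4 * t / ρ ^ 2 * (‖a (k + 2)‖ * ρ ^ (k + 2))) := by
          refine ENNReal.tsum_le_tsum fun k => ?_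
          have : ‖g k‖ₑ * 2 ^ (k + 2) = ENNReal.ofReal (‖g k‖ * 2 ^ (k + 2)) := by
            rw [ENNReal.ofReal_mul (norm_nonneg _), ofReal_norm,
              ENNReal.ofReal_pow (by norm_num)]
            norm_num
          rw [this]
          apply ENNReal.ofReal_le_ofReal
          rw [hg, norm_mul, norm_pow, Complex.norm_real, Real.norm_of_nonneg ht0.le]
          calc ‖a (k + 2)‖ * t ^ (k + 1) * 2 ^ (k + 2) = ‖a (k + 2)‖ * (4 * t) * (2 * t) ^ k := by
                rw [mul_pow]; ring
            _ ≤ ‖a (k + 2)‖ * (4 * t) * ρ ^ k := by gcongr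
            _ = _ := by field_simp; ring
      _ = ENNReal.ofReal (4 * t / ρ ^ 2 * M) := by
          rw [hM, ← tsum_mul_left, ENNReal.ofReal_tsum_of_nonneg (fun k => by positivity)
            (ha.mul_left _)]
      _ ≤ 1 := by rw [← ENNReal.ofReal_one]; exact ENNReal.ofReal_le_ofReal ht2
  -- the weights
  obtain ⟨v, hvdef⟩ : ∃ v : ℕ → ENNReal, ∀ n, v n = ENNReal.ofReal (Real.exp (- K n)) :=
    ⟨_, fun _ => rfl⟩
  have hv : ∀ i j, v (i + j) ≤ v i * v j := by
    intro i j
    rw [hvdef, hvdef, hvdef, ← ENNReal.ofReal_mul (Real.exp_pos _).le, ← Real.exp_add]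
    apply ENNReal.ofReal_le_ofReal
    apply Real.exp_le_exp.2
    linarith [hKadd i j]
  have hvle : ∀ n, v n ≤ 1 := by
    intro n
    rw [hvdef, ← ENNReal.ofReal_one]
    apply ENNReal.ofReal_le_ofReal
    rw [Real.exp_le_one_iff]; linarith [hKnn n]
  have hlam0 : lam ≠ 0 := by intro h; rw [h] at hnorm; simp at hnorm
  have hne : ∀ j : ℕ, lam * (lam ^ (j + 1) - 1) ≠ 0 := fun j =>
    mul_ne_zero hlam0 (norm_pos_iff.1 (hpos (j + 1) (by omega)))
  have hd : ∀ j, ‖(lam * (lam ^ (j + 1) - 1))⁻¹‖ₑ * v (j + 1) ≤ v j := by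
    intro j
    rw [hvdef, hvdef, ← ofReal_norm, ← ENNReal.ofReal_mul (norm_nonneg _)]
    apply ENNReal.ofReal_le_ofReal
    rw [norm_inv, norm_mul, hnorm, one_mul]
    have hp := hpos (j + 1) (by omega)
    have : ‖lam ^ (j + 1) - 1‖⁻¹ = Real.exp (- Real.log ‖lam ^ (j + 1) - 1‖) := by
      rw [Real.exp_neg, Real.exp_log hp]
    rw [this, ← Real.exp_add]
    apply Real.exp_le_exp.2
    linarith [hKd j]
  obtain ⟨u, hu0, hu2, hu⟩ := bj_formal v hv (hvle 0) (hvle 1) lam hne hd g hgs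
  have hutop : bjNorm v u ≠ ⊤ := ne_top_of_le_ne_top (by simp) hu2
  -- the radius
  set r := Real.exp (- C) with hr
  have hr0 : 0 < r := Real.exp_pos _
  have hr1 : r ≤ 1 := by rw [hr, Real.exp_le_one_iff]; linarith
  have hz : ∀ z : ℂ, ‖z‖ ≤ r → ∀ n, ‖z‖ₑ ^ n ≤ v n := by
    intro z hz n
    rw [hvdef, ← ofReal_norm, ← ENNReal.ofReal_pow (norm_nonneg _)]
    apply ENNReal.ofReal_le_ofReal
    calc ‖z‖ ^ n ≤ r ^ n := by gcongr
      _ = Real.exp (n * (-C)) := by rw [hr, ← Real.exp_nat_mul]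
      _ ≤ _ := by apply Real.exp_le_exp.2; linarith [hKC n]
  have hevb : ∀ z : ℂ, ‖z‖ ≤ r → ‖bjEv z u‖ ≤ 2 := by
    intro z hzr
    have h1 : ‖bjEv z u‖ₑ ≤ 2 :=
      enorm_tsum_le_tsum_enorm.trans ((bj_ev_le v z (hz z hzr) u).trans hu2)
    rw [← ofReal_norm] at h1
    have h2 : (2 : ENNReal) = ENNReal.ofReal 2 := by norm_num
    rw [h2] at h1
    exact (ENNReal.ofReal_le_ofReal_iff (by norm_num)).1 h1
  have hevd : DifferentiableOn ℂ (fun z => bjEv z u) (ball 0 r) := by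
    have hrn : ‖(r : ℂ)‖ = r := by rw [Complex.norm_real, Real.norm_of_nonneg hr0.le]
    refine Complex.differentiableOn_tsum_of_summable_norm
      (bj_ev_summable v (r : ℂ) (hz _ hrn.le) u hutop) (fun i => by fun_prop) isOpen_ball ?_
    intro i w hw
    rw [mem_ball_zero_iff] at hw
    rw [norm_mul, norm_mul, norm_pow, norm_pow, hrn]
    gcongr
  -- the functional equation for `u`
  have hfe : ∀ z : ℂ, ‖z‖ ≤ r → lam * (bjEv (lam * z) u - bjEv z u) = z * bjEv z (bjW g u) := by
    intro z hzr
    have hzl : ‖lam * z‖ ≤ r := by rw [norm_mul, hnorm, one_mul]; exact hzr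
    have s1 := (bj_ev_summable v z (hz z hzr) u hutop).of_norm
    have s2 := (bj_ev_summable v (lam * z) (hz _ hzl) u hutop).of_norm
    unfold bjEv
    rw [s1.tsum_eq_zero_add, s2.tsum_eq_zero_add]
    have s1' := (summable_nat_add_iff 1).2 s1
    have s2' := (summable_nat_add_iff 1).2 s2
    rw [pow_zero, pow_zero, add_sub_add_left_eq_sub, ← s2'.tsum_sub s1', ← tsum_mul_left, ← tsum_mul_left]
    refine tsum_congr fun j => ?_
    rw [← hu j, mul_pow]; ring
  have hmain : ∀ z : ℂ, ‖z‖ ≤ r → f (t * z * bjEv z u) = t * (lam * z) * bjEv (lam * z) u := by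
    intro z hzr
    have hle : ‖(t : ℂ) * z * bjEv z u‖ ≤ ρ := by
      rw [norm_mul, norm_mul, Complex.norm_real, Real.norm_of_nonneg ht0.le]
      calc t * ‖z‖ * ‖bjEv z u‖ ≤ t * 1 * 2 := by
            have := hevb z hzr
            gcongr
            linarith
        _ ≤ ρ := by linarith
    have e := hfe z hzr
    rw [bj_ev_W v hv (hvle 0) (hvle 1) z (hz z hzr) g hgs u hu2] at e
    have e2 : ∑' k, a (k + 2) * ((t : ℂ) * z * bjEv z u) ^ (k + 2) =
        t * z * (z * ∑' k, g k * (z ^ k * bjEv z u ^ (k + 2))) := by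
      rw [← tsum_mul_left, ← tsum_mul_left]
      refine tsum_congr fun k => ?_
      rw [hg, mul_pow, mul_pow]; ring
    rw [hf _ hle, e2, ← e]; ring
  -- injectivity near `0`
  set h : ℂ → ℂ := fun z => t * z * bjEv z u with hh
  have hhd : DifferentiableOn ℂ h (ball 0 r) := by
    refine DifferentiableOn.mul (by fun_prop) hevd
  have hev0 : bjEv 0 u = 1 := by
    rw [bjEv, tsum_eq_single 0]
    · simpa using hu0
    · intro n hn; simp [hn]
  have hder : deriv h 0 = t := by
    have h1 : HasDerivAt (fun z => bjEv z u) (deriv (fun z => bjEv z u) 0) 0 :=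
      (hevd.differentiableAt (ball_mem_nhds _ hr0)).hasDerivAt
    have h2 : HasDerivAt (fun z : ℂ => (t : ℂ) * z) t 0 := by
      simpa using (hasDerivAt_id (0 : ℂ)).const_mul (t : ℂ)
    have h3 := h2.mul h1
    have h4 := h3.deriv
    rw [hev0] at h4
    simp only [mul_one, mul_zero, zero_mul, add_zero] at h4
    exact h4
  have hstr : HasStrictDerivAt h t 0 := by
    rw [← hder]
    exact (hhd.analyticAt (ball_mem_nhds _ hr0)).hasStrictDerivAt
  have htne : (t : ℂ) ≠ 0 := by exact_mod_cast ht0.ne'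
  obtain ⟨ε, hε, hinj⟩ := Metric.eventually_nhds_iff_ball.1 (hstr.eventually_left_inverse htne)
  refine ⟨min r ε, lt_min hr0 hε, h, hhd.mono (ball_subset_ball (min_le_left _ _)), ?_, ?_, ?_⟩
  · intro x hx y hy hxy
    rw [← hinj x (ball_subset_ball (min_le_right _ _) hx),
      ← hinj y (ball_subset_ball (min_le_right _ _) hy), hxy]
  · simp [hh]
  · intro z hzb
    have : ‖z‖ < min r ε := mem_ball_zero_iff.1 hzb
    exact hmain z (this.le.trans (min_le_left _ _))

/-- **Brjuno's theorem**: if `α` is irrational and satisfies the Brjuno condition, then any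
holomorphic germ fixing `0` with multiplier `e^{2πiα}` is linearizable. -/
theorem brjuno_linearizable (α : ℝ) (hα : Irrational α) (hB : BrjunoCondition α)
    (lam : ℂ) (hlam : lam = Complex.exp (2 * Real.pi * Complex.I * α))
    (f : ℂ → ℂ) (U : Set ℂ) (hU : IsOpen U) (h0U : (0 : ℂ) ∈ U)
    (hf : DifferentiableOn ℂ f U) (hf0 : f 0 = 0) (hf'0 : deriv f 0 = lam) :
    LinearizableAt f 0 lam := by
  have hq0 : contFracDen α 0 = 1 := GenContFract.zeroth_den_eq_one
  have hnorm : ‖lam‖ = 1 := by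
    have e : (2 * Real.pi * Complex.I * α : ℂ) = ((2 * Real.pi * α : ℝ) : ℂ) * Complex.I := by
      push_cast; ring
    rw [hlam, e, Complex.norm_exp_ofReal_mul_I]
  have hpos : ∀ k : ℕ, 1 ≤ k → 0 < ‖lam ^ k - 1‖ := by
    rw [hlam]; exact bj_norm_pos α hα
  obtain ⟨K, C, hK0, hC, hKnn, hKC, hKadd, hKd⟩ := bj_davie (contFracDen α) (bj_dens_ge_one α hα)
    hq0 (bj_dens_tendsto α hα) hB lam hnorm hpos (by rw [hlam]; exact bj_norm_lower α hα)
  obtain ⟨ρ, a, hρ, ha, hfa⟩ := bj_expand lam f U hU h0U hf hf0 hf'0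
  exact bj_main lam hnorm hpos K C hK0 hC hKnn hKC hKadd hKd f ρ a hρ ha hfa
end

section
/- Let P and Q be complex polynomials with deg P = p ≥ 0 and deg Q = q ≥ 1 (leading coefficients nonzero), b ∈ ℂ, and define the entire function f(z) := b + ∫₀^z P(t)e^{Q(t)} dt. Then the set of finite asymptotic values of f is finite and has cardinality at most q. -/
open Metric Set Filter

/-- The complex line integral `∫₀^z g(t) dt` of an entire function `g` from `0` to `z`
(computed along the straight segment; it is path-independent for entire `g`). -/
noncomputable def lineIntegral (g : ℂ → ℂ) (z : ℂ) : ℂ :=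
  z * ∫ t in (0:ℝ)..1, g ((t : ℂ) * z)

/-- `a` is a finite asymptotic value of `f`: there is a continuous curve `γ` tending to `∞`
along which `f` tends to `a`. -/
def AsymptoticValue (f : ℂ → ℂ) (a : ℂ) : Prop :=
  ∃ γ : ℝ → ℂ, Continuous γ ∧ Tendsto (fun t => ‖γ t‖) atTop atTop ∧
    Tendsto (fun t => f (γ t)) atTop (nhds a)


open Bornology Asymptotics

namespace AsymVal

lemma hasDerivAt_lineIntegral (g : ℂ → ℂ) (hg : Differentiable ℂ g) (z : ℂ) :
    HasDerivAt (lineIntegral g) (g z) z := by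
  obtain ⟨G, hG⟩ := (hg.differentiableOn (s := ball 0 (‖z‖ + 1))).isExactOn_ball
  have hz : z ∈ ball (0:ℂ) (‖z‖ + 1) := by simp
  have key : ∀ y ∈ ball (0:ℂ) (‖z‖ + 1), lineIntegral g y = G y - G 0 := by
    intro y hy
    unfold lineIntegral
    rw [← intervalIntegral.integral_const_mul]
    have := intervalIntegral.integral_eq_sub_of_hasDerivAt (a := 0) (b := 1)
      (f := fun t : ℝ => G ((t:ℂ) * y)) (f' := fun t : ℝ => y * g ((t:ℂ) * y)) ?_ ?_
    · rw [this]; simp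
    · intro t ht
      rw [uIcc_of_le zero_le_one] at ht
      have hty : (t:ℂ) * y ∈ ball (0:ℂ) (‖z‖ + 1) := by
        simp only [mem_ball_zero_iff, norm_mul, Complex.norm_real, Real.norm_eq_abs] at hy ⊢
        rw [abs_of_nonneg ht.1]
        nlinarith [ht.2, norm_nonneg y]
      have h1 : HasDerivAt (fun t : ℂ => G (t * y)) (g ((t:ℂ) * y) * (1 * y)) (t:ℂ) :=
        HasDerivAt.comp (h₂ := G) (t:ℂ) (hG _ hty) ((hasDerivAt_id (t:ℂ)).mul_const y)
      have := h1.comp_ofReal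
      refine HasDerivAt.congr_deriv this ?_
      ring
    · apply Continuous.intervalIntegrable
      have := hg.continuous
      fun_prop
  have := (hG z hz).sub_const (G 0)
  refine this.congr_of_eventuallyEq ?_
  filter_upwards [isOpen_ball.mem_nhds hz] with y hy using key y hy

lemma ode (l g M N : ℝ → ℂ) (ε : ℝ)
    (hl0 : ∀ s ∈ Icc (0:ℝ) 1, l s ≠ 0)
    (hl : ∀ s ∈ Icc (0:ℝ) 1, HasDerivAt l (M s * l s) s)
    (hg : ∀ s ∈ Icc (0:ℝ) 1, HasDerivAt g (N s * l s) s)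
    (hN : ∀ s ∈ Icc (0:ℝ) 1, ‖N s‖ ≤ ε * (M s).re) :
    ‖g 1 - g 0‖ ≤ ε * (‖l 1‖ - ‖l 0‖) ∧
    ∀ κ : ℝ, (∀ s ∈ Icc (0:ℝ) 1, κ ≤ (M s).re) → ‖l 0‖ * Real.exp κ ≤ ‖l 1‖ := by
  have hn : ∀ s ∈ Icc (0:ℝ) 1, HasDerivAt (fun s => ‖l s‖) ((M s).re * ‖l s‖) s := by
    intro s hs
    have h1 := (hl s hs).norm_sq
    have h0 : ‖l s‖ ≠ 0 := norm_ne_zero_iff.2 (hl0 s hs)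
    have h2 := h1.sqrt (by positivity)
    simp only [Real.sqrt_sq (norm_nonneg _)] at h2
    convert h2 using 1
    have : inner ℝ (l s) (M s * l s) = (M s).re * ‖l s‖ ^ 2 := by
      rw [Complex.sq_norm, Complex.normSq_apply]
      simp [Complex.inner]
      ring
    rw [this]
    field_simp
  constructor
  · have := image_norm_le_of_norm_deriv_right_le_deriv_boundary' (a := 0) (b := 1)
      (f := fun s => g s - g 0) (f' := fun s => N s * l s)
      (B := fun s => ε * (‖l s‖ - ‖l 0‖)) (B' := fun s => ε * ((M s).re * ‖l s‖))
      (fun s hs => ((hg s hs).sub_const _).continuousAt.continuousWithinAt)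
      (fun s hs => ((hg s (Ico_subset_Icc_self hs)).sub_const _).hasDerivWithinAt)
      (by simp)
      (fun s hs => (((hn s hs).sub_const _).const_mul ε).continuousAt.continuousWithinAt)
      (fun s hs => (((hn s (Ico_subset_Icc_self hs)).sub_const _).const_mul ε).hasDerivWithinAt)
      (fun s hs => by
        rw [norm_mul, ← mul_assoc]
        exact mul_le_mul_of_nonneg_right (hN s (Ico_subset_Icc_self hs)) (norm_nonneg _))
    exact this (right_mem_Icc.2 zero_le_one)
  · intro κ hκ
    have hd : ∀ s ∈ Icc (0:ℝ) 1, HasDerivAt (fun s => ‖l s‖ * Real.exp (-(κ * s)))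
        (((M s).re - κ) * ‖l s‖ * Real.exp (-(κ * s))) s := by
      intro s hs
      have := (hn s hs).mul ((((hasDerivAt_id s).const_mul κ).neg).exp)
      refine HasDerivAt.congr_deriv this ?_
      simp; ring
    have hm : MonotoneOn (fun s => ‖l s‖ * Real.exp (-(κ * s))) (Icc 0 1) := by
      apply monotoneOn_of_deriv_nonneg (convex_Icc 0 1)
      · exact fun s hs => (hd s hs).continuousAt.continuousWithinAt
      · exact fun s hs => (hd s (interior_subset hs)).differentiableAt.differentiableWithinAt
      · intro s hs
        rw [(hd s (interior_subset hs)).deriv]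
        have := hκ s (interior_subset hs)
        have : 0 ≤ (M s).re - κ := by linarith
        positivity
    have := hm (left_mem_Icc.2 zero_le_one) (right_mem_Icc.2 zero_le_one) zero_le_one
    simp only [mul_zero, neg_zero, Real.exp_zero, mul_one] at this
    rw [Real.exp_neg] at this
    have he := Real.exp_pos κ
    calc ‖l 0‖ * Real.exp κ ≤ ‖l 1‖ * (Real.exp κ)⁻¹ * Real.exp κ := by gcongr
      _ = ‖l 1‖ := by field_simp

/-- main term -/
noncomputable def L (P Q : Polynomial ℂ) (z : ℂ) : ℂ :=
  P.eval z / Q.derivative.eval z * Complex.exp (Q.eval z)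

/-- relative error -/
noncomputable def E (P Q : Polynomial ℂ) (z : ℂ) : ℂ :=
  (P.derivative.eval z / P.eval z - Q.derivative.derivative.eval z / Q.derivative.eval z)
    / Q.derivative.eval z

lemma hasDerivAt_L (P Q : Polynomial ℂ) (z : ℂ) (hP : P.eval z ≠ 0)
    (hQ : Q.derivative.eval z ≠ 0) :
    HasDerivAt (L P Q) (Q.derivative.eval z * (1 + E P Q z) * L P Q z) z := by
  have := ((P.hasDerivAt z).div (Q.derivative.hasDerivAt z) hQ).mul ((Q.hasDerivAt z).cexp)
  refine HasDerivAt.congr_deriv this ?_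
  simp only [L, E, Pi.div_apply]
  field_simp
  ring

lemma L_ne_zero (P Q : Polynomial ℂ) (z : ℂ) (hP : P.eval z ≠ 0)
    (hQ : Q.derivative.eval z ≠ 0) : L P Q z ≠ 0 :=
  mul_ne_zero (div_ne_zero hP hQ) (Complex.exp_ne_zero _)

lemma path (P Q : Polynomial ℂ) (f : ℂ → ℂ)
    (hf : ∀ z, HasDerivAt f (P.eval z * Complex.exp (Q.eval z)) z)
    (z z' : ℝ → ℂ) (e m : ℝ) (hm : 0 < m) (hem : e ≤ m / 2)
    (hz : ∀ s ∈ Icc (0:ℝ) 1, HasDerivAt z (z' s) s)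
    (hP : ∀ s ∈ Icc (0:ℝ) 1, P.eval (z s) ≠ 0)
    (hQ : ∀ s ∈ Icc (0:ℝ) 1, Q.derivative.eval (z s) ≠ 0)
    (hE : ∀ s ∈ Icc (0:ℝ) 1, ‖E P Q (z s)‖ ≤ e)
    (hre : ∀ s ∈ Icc (0:ℝ) 1, m * ‖z' s * Q.derivative.eval (z s)‖
      ≤ (z' s * Q.derivative.eval (z s)).re) :
    ‖(f (z 1) - L P Q (z 1)) - (f (z 0) - L P Q (z 0))‖ ≤ (2 * e / m) * ‖L P Q (z 1)‖ ∧
    ∀ κ : ℝ, (∀ s ∈ Icc (0:ℝ) 1, κ ≤ m / 2 * ‖z' s * Q.derivative.eval (z s)‖) →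
      ‖L P Q (z 0)‖ * Real.exp κ ≤ ‖L P Q (z 1)‖ := by
  have he : 0 ≤ e := (norm_nonneg _).trans (hE 0 (left_mem_Icc.2 zero_le_one))
  have hM : ∀ s ∈ Icc (0:ℝ) 1, m / 2 * ‖z' s * Q.derivative.eval (z s)‖ ≤
      (z' s * Q.derivative.eval (z s) * (1 + E P Q (z s))).re := by
    intro s hs
    set y := z' s * Q.derivative.eval (z s)
    have h1 : -(y * E P Q (z s)).re ≤ ‖y‖ * e := by
      calc -(y * E P Q (z s)).re ≤ |(y * E P Q (z s)).re| := neg_le_abs _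
        _ ≤ ‖y * E P Q (z s)‖ := Complex.abs_re_le_norm _
        _ = ‖y‖ * ‖E P Q (z s)‖ := norm_mul _ _
        _ ≤ _ := by gcongr; exact hE s hs
    have h2 := hre s hs
    rw [mul_add, mul_one, Complex.add_re]
    nlinarith [norm_nonneg y, mul_le_mul_of_nonneg_left hem (norm_nonneg y)]
  have := ode (fun s => L P Q (z s)) (fun s => f (z s) - L P Q (z s))
    (fun s => z' s * Q.derivative.eval (z s) * (1 + E P Q (z s)))
    (fun s => -(z' s * Q.derivative.eval (z s) * E P Q (z s))) (2 * e / m)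
    (fun s hs => L_ne_zero _ _ _ (hP s hs) (hQ s hs)) ?_ ?_ ?_
  · refine ⟨this.1.trans ?_, fun κ hκ => this.2 κ fun s hs => (hκ s hs).trans (hM s hs)⟩
    apply mul_le_mul_of_nonneg_left _ (by positivity)
    have := norm_nonneg (L P Q (z 0))
    linarith
  · intro s hs
    have := (hasDerivAt_L P Q (z s) (hP s hs) (hQ s hs)).scomp s (hz s hs)
    refine HasDerivAt.congr_deriv this ?_
    simp only [smul_eq_mul]; ring
  · intro s hs
    have := ((hf (z s)).scomp s (hz s hs)).sub
      ((hasDerivAt_L P Q (z s) (hP s hs) (hQ s hs)).scomp s (hz s hs))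
    refine HasDerivAt.congr_deriv this ?_
    have := hQ s hs
    simp only [L, smul_eq_mul]
    field_simp
    ring
  · intro s hs
    rw [norm_neg, norm_mul]
    calc _ ≤ ‖z' s * Q.derivative.eval (z s)‖ * e := by gcongr; exact hE s hs
      _ = (2 * e / m) * (m / 2 * ‖z' s * Q.derivative.eval (z s)‖) := by field_simp
      _ ≤ _ := mul_le_mul_of_nonneg_left (hM s hs) (by positivity)

lemma eventually_ne (P : Polynomial ℂ) (hP : P ≠ 0) : ∀ᶠ z in cobounded ℂ, P.eval z ≠ 0 := by
  have h : Set.Finite {z | P.IsRoot z} := Polynomial.finite_setOfPred_isRoot hP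
  exact Bornology.IsBounded.compl (Set.Finite.isBounded h)

lemma derivative_ne (Q : Polynomial ℂ) (hq : 1 ≤ Q.natDegree) : Q.derivative ≠ 0 := by
  intro h
  have := Polynomial.derivative_eq_zero.1 h
  omega

lemma tendsto_E (P Q : Polynomial ℂ) (hP : P ≠ 0) (hq : 1 ≤ Q.natDegree) :
    Tendsto (E P Q) (cobounded ℂ) (nhds 0) := by
  have hQ := derivative_ne Q hq
  have h1 := (Polynomial.isLittleO_cobounded_of_degree_lt
    (Polynomial.degree_derivative_lt hP)).tendsto_div_nhds_zero
  have h2 := (Polynomial.isLittleO_cobounded_of_degree_lt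
    (Polynomial.degree_derivative_lt hQ)).tendsto_div_nhds_zero
  have h3 := (isLittleO_one_iff ℂ).2 (by simpa using h1.sub h2 : Tendsto (fun z => P.derivative.eval z / P.eval z - Q.derivative.derivative.eval z / Q.derivative.eval z) (cobounded ℂ) (nhds 0))
  have h4 : (Polynomial.eval · (1 : Polynomial ℂ)) =O[cobounded ℂ] Q.derivative.eval :=
    Polynomial.isBigO_cobounded_of_degree_le (by
      rw [Polynomial.degree_one]; exact Polynomial.zero_le_degree_iff.2 hQ)
  simp only [Polynomial.eval_one] at h4
  exact (h3.trans_isBigO h4).tendsto_div_nhds_zero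

lemma eventually_zQ (Q : Polynomial ℂ) (hq : 1 ≤ Q.natDegree) (e : ℝ) (he : 0 < e) :
    ∀ᶠ z in cobounded ℂ, ‖z * Q.derivative.eval z - Q.natDegree * (Q.leadingCoeff * z ^ Q.natDegree)‖
      ≤ e * ‖Q.natDegree * (Q.leadingCoeff * z ^ Q.natDegree)‖ := by
  have h := (Polynomial.isEquivalent_cobounded_leading_monomial (P := Q.derivative)).isLittleO
  filter_upwards [h.bound he] with z hz
  have hd : Q.derivative.natDegree = Q.natDegree - 1 := Polynomial.natDegree_derivative Q
  have hl : Q.derivative.leadingCoeff = Q.leadingCoeff * Q.natDegree := by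
    rw [Polynomial.leadingCoeff, hd, Polynomial.coeff_derivative, Nat.sub_add_cancel hq]
    congr 1
    exact_mod_cast Nat.sub_add_cancel hq
  rw [hd, hl] at hz
  obtain ⟨k, hk⟩ : ∃ k, Q.natDegree = k + 1 := ⟨Q.natDegree - 1, by omega⟩
  rw [hk] at hz ⊢
  simp only [Pi.sub_apply, Nat.add_sub_cancel] at hz
  calc _ = ‖z‖ * ‖Q.derivative.eval z - Q.leadingCoeff * ((k+1 : ℕ):ℂ) * z ^ k‖ := by
        rw [← norm_mul]; congr 1; ring
    _ ≤ ‖z‖ * (e * ‖Q.leadingCoeff * ((k+1 : ℕ):ℂ) * z ^ k‖) := by gcongr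
    _ = _ := by simp only [norm_mul, norm_pow]; ring

/-- all eventual estimates, packaged with a radius -/
lemma exists_radius (P Q : Polynomial ℂ) (hP : P ≠ 0) (hq : 1 ≤ Q.natDegree) (e : ℝ) (he : 0 < e) :
    ∃ R : ℝ, 1 ≤ R ∧ ∀ z : ℂ, R ≤ ‖z‖ → P.eval z ≠ 0 ∧ Q.derivative.eval z ≠ 0 ∧ ‖E P Q z‖ ≤ e ∧
      ‖z * Q.derivative.eval z - Q.natDegree * (Q.leadingCoeff * z ^ Q.natDegree)‖
      ≤ e * ‖Q.natDegree * (Q.leadingCoeff * z ^ Q.natDegree)‖ := by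
  have h := (eventually_ne P hP).and ((eventually_ne _ (derivative_ne Q hq)).and
    (((tendsto_E P Q hP hq).norm.eventually_le_const (u := e) (by simpa using he)).and
      (eventually_zQ Q hq e he)))
  obtain ⟨R, -, hR⟩ := (hasBasis_cobounded_norm (E := ℂ)).eventually_iff.1 h
  exact ⟨max R 1, le_max_right _ _, fun z hz => hR ((le_max_left _ _).trans hz)⟩

lemma tendsto_B (P Q : Polynomial ℂ) (hP : P ≠ 0) (hq : 1 ≤ Q.natDegree) (f : ℂ → ℂ)
    (hf : ∀ z, HasDerivAt f (P.eval z * Complex.exp (Q.eval z)) z) :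
    Tendsto (fun z => ‖f z‖) (cobounded ℂ ⊓ 𝓟 {z | ‖Q.leadingCoeff * z ^ Q.natDegree‖ / 2
      ≤ (Q.leadingCoeff * z ^ Q.natDegree).re}) atTop := by
  set c := Q.leadingCoeff with hc
  set q := Q.natDegree with hqd
  have hc0 : c ≠ 0 := by
    rw [hc, Polynomial.leadingCoeff_ne_zero]
    rintro rfl
    simp at hqd; omega
  have hqpos : (0:ℝ) < q := by exact_mod_cast hq
  obtain ⟨R₁, hR₁, hR₁'⟩ := exists_radius P Q hP hq (1/20) (by norm_num)
  obtain ⟨R, hR1, hR2⟩ : ∃ R, R₁ ≤ R ∧ 40 / ‖c‖ ≤ R := ⟨_, le_max_left _ _, le_max_right _ _⟩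
  have hR0 : 0 < R := by linarith
  have hRR : ∀ z : ℂ, R ≤ ‖z‖ → _ := fun z hz => hR₁' z (hR1.trans hz)
  -- bounds on the sphere
  have hLc : ContinuousOn (L P Q) (sphere 0 R) := fun z hz => by
    have := hRR z (by simpa using (mem_sphere_zero_iff_norm.1 hz).ge)
    exact (hasDerivAt_L P Q z this.1 this.2.1).continuousAt.continuousWithinAt
  have hfc : Continuous f := continuous_iff_continuousAt.2 fun z => (hf z).continuousAt
  obtain ⟨K, hK⟩ := (isCompact_sphere (0:ℂ) R).exists_bound_of_continuousOn
    (hfc.continuousOn.sub hLc)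
  obtain ⟨z₁, hz₁, hmin⟩ := (isCompact_sphere (0:ℂ) R).exists_isMinOn
    (NormedSpace.sphere_nonempty.2 hR0.le) hLc.norm
  have hμ : 0 < ‖L P Q z₁‖ := by
    have := hRR z₁ (by simpa using (mem_sphere_zero_iff_norm.1 hz₁).ge)
    exact norm_pos_iff.2 (L_ne_zero _ _ _ this.1 this.2.1)
  set μ := ‖L P Q z₁‖
  have key : ∀ z : ℂ, R ≤ ‖z‖ → ‖c * z ^ q‖ / 2 ≤ (c * z ^ q).re →
      (1/2) * (μ * (‖z‖ / R)) - K ≤ ‖f z‖ := by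
    intro z hz hre
    have hz0 : 0 < ‖z‖ := hR0.trans_le hz
    set Λ := Real.log (‖z‖ / R) with hΛ
    have hΛ0 : 0 ≤ Λ := Real.log_nonneg (by rw [le_div_iff₀ hR0]; linarith)
    let ρ : ℝ → ℝ := fun s => Real.exp (s * Λ) * (R / ‖z‖)
    have hρpos : ∀ s, 0 < ρ s := fun s => by positivity
    have hρn : ∀ s ∈ Icc (0:ℝ) 1, R ≤ ‖(ρ s : ℂ) * z‖ := by
      intro s hs
      rw [norm_mul, Complex.norm_real, Real.norm_of_nonneg (hρpos s).le]
      have : 1 ≤ Real.exp (s * Λ) := Real.one_le_exp (mul_nonneg hs.1 hΛ0)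
      have h2 : ρ s * ‖z‖ = Real.exp (s * Λ) * R := by simp only [ρ]; field_simp
      rw [h2]; nlinarith
    have hzz : ∀ s ∈ Icc (0:ℝ) 1,
        let y := ((ρ s : ℂ) * z) * Q.derivative.eval ((ρ s : ℂ) * z)
        (1/5) * ‖y‖ ≤ y.re ∧ 10 ≤ ‖y‖ := by
      intro s hs y
      obtain ⟨-, -, -, h⟩ := hRR _ (hρn s hs)
      rw [← hc, ← hqd] at h
      change ‖y - _‖ ≤ _ at h
      set v := (q:ℂ) * (c * ((ρ s : ℂ) * z) ^ q) with hv
      have hv' : v = ((q * ρ s ^ q : ℝ) : ℂ) * (c * z ^ q) := by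
        rw [hv]; push_cast; ring
      have hvre : ‖v‖ / 2 ≤ v.re := by
        rw [hv', norm_mul, Complex.re_ofReal_mul, Complex.norm_real, Real.norm_of_nonneg]
        · have : 0 ≤ q * ρ s ^ q := by have := hρpos s; positivity
          nlinarith
        · have := hρpos s; positivity
      have hvn : 40 ≤ ‖v‖ := by
        have h1 : R ≤ ‖(ρ s : ℂ) * z‖ ^ q :=
          (hρn s hs).trans (le_self_pow₀ ((hR₁.trans hR1).trans (hρn s hs)) (by omega))
        have h2 : (1:ℝ) ≤ q := by exact_mod_cast hq
        have hcn := norm_pos_iff.2 hc0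
        rw [div_le_iff₀ hcn] at hR2
        rw [hv, norm_mul, norm_mul, norm_pow, Complex.norm_natCast]
        have h3 : 40 ≤ ‖c‖ * ‖(ρ s : ℂ) * z‖ ^ q := by nlinarith
        nlinarith
      have h1 : |(y - v).re| ≤ ‖y - v‖ := Complex.abs_re_le_norm _
      rw [Complex.sub_re, abs_le] at h1
      have h2 := norm_sub_norm_le y v
      have h3 := norm_sub_norm_le v y
      rw [norm_sub_rev] at h3
      constructor <;> linarith
    have := path P Q f hf (fun s => (ρ s : ℂ) * z) (fun s => (Λ:ℂ) * ((ρ s : ℂ) * z)) (1/20) (1/5)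
      (by norm_num) (by norm_num) ?_ (fun s hs => (hRR _ (hρn s hs)).1)
      (fun s hs => (hRR _ (hρn s hs)).2.1) (fun s hs => (hRR _ (hρn s hs)).2.2.1) ?_
    · obtain ⟨h1, h2⟩ := this
      have h2 := h2 Λ ?_
      · have hz1 : (ρ 1 : ℂ) * z = z := by
          have : ρ 1 = 1 := by
            simp only [ρ, one_mul, hΛ]
            rw [Real.exp_log (by positivity)]; field_simp
          rw [this]; simp
        have hz0s : (ρ 0 : ℂ) * z ∈ sphere (0:ℂ) R := by
          rw [mem_sphere_zero_iff_norm, norm_mul, Complex.norm_real,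
            Real.norm_of_nonneg (hρpos 0).le]
          simp only [ρ, zero_mul, Real.exp_zero]; field_simp
        have hk := hK _ hz0s
        have hm := hmin hz0s
        simp only [mem_ofPred_eq] at hm
        simp only [hz1] at h1 h2
        rw [hΛ, Real.exp_log (by positivity)] at h2
        have h3 : μ * (‖z‖ / R) ≤ ‖L P Q z‖ :=
          le_trans (mul_le_mul_of_nonneg_right hm (by positivity)) h2
        simp only [Pi.sub_apply] at hk
        set A := f (↑(ρ 0) * z) - L P Q (↑(ρ 0) * z)
        have h4 : ‖L P Q z‖ ≤ ‖f z‖ + ‖f z - L P Q z - A‖ + ‖A‖ := by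
          calc ‖L P Q z‖ = ‖f z - (f z - L P Q z - A) - A‖ := by congr 1; ring
            _ ≤ ‖f z - (f z - L P Q z - A)‖ + ‖A‖ := norm_sub_le _ _
            _ ≤ _ := by gcongr; exact norm_sub_le _ _
        linarith
      · intro s hs
        rw [mul_assoc, norm_mul, Complex.norm_real, Real.norm_of_nonneg hΛ0]
        have := (hzz s hs).2
        nlinarith
    · intro s hs
      have h1 : HasDerivAt ρ (Λ * ρ s) s := by
        have := (((hasDerivAt_id s).mul_const Λ).exp).mul_const (R / ‖z‖)
        refine HasDerivAt.congr_deriv this ?_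
        simp only [ρ, id]; ring
      refine HasDerivAt.congr_deriv (h1.ofReal_comp.mul_const z) ?_
      push_cast; ring
    · intro s hs
      rw [mul_assoc, norm_mul, Complex.norm_real, Real.norm_of_nonneg hΛ0, Complex.re_ofReal_mul]
      have := (hzz s hs).1
      nlinarith
  have hlim : Tendsto (fun z : ℂ => (1/2) * (μ * (‖z‖ / R)) - K) (cobounded ℂ) atTop := by
    have h := tendsto_norm_cobounded_atTop (E := ℂ)
    have := tendsto_atTop_add_const_right _ (-K) (h.const_mul_atTop (r := μ / (2 * R))
      (by positivity))
    refine this.congr fun z => ?_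
    field_simp; ring
  refine tendsto_atTop_mono' _ ?_ (hlim.mono_left inf_le_left)
  have h1 : ∀ᶠ z : ℂ in cobounded ℂ, R ≤ ‖z‖ :=
    tendsto_norm_cobounded_atTop.eventually_ge_atTop R
  filter_upwards [h1.filter_mono inf_le_left, mem_inf_of_right (mem_principal_self _)] with z h1 h2
  exact key z h1 h2

/-- `q`-th root parametrisation of the sector. -/
noncomputable def zeta (q : ℕ) (τ w : ℂ) : ℂ := τ * Complex.exp (Complex.log w / q)

lemma zeta_pow (q : ℕ) (hq : 1 ≤ q) (τ w : ℂ) (hw : w ≠ 0) : zeta q τ w ^ q = τ ^ q * w := by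
  unfold zeta
  rw [mul_pow, ← Complex.exp_nat_mul, mul_div_cancel₀, Complex.exp_log hw]
  exact_mod_cast (by omega : q ≠ 0)

lemma hasDerivAt_zeta (q : ℕ) (τ w : ℂ) (hw : w ∈ Complex.slitPlane) :
    HasDerivAt (zeta q τ) (zeta q τ w / (q * w)) w := by
  have := ((((Complex.hasDerivAt_log hw).div_const (q:ℂ)).cexp).const_mul τ)
  refine HasDerivAt.congr_deriv this ?_
  simp only [zeta]
  have := Complex.slitPlane_ne_zero hw
  simp only [div_eq_mul_inv, mul_inv]; ring

lemma slit_of (w : ℂ) (h0 : w ≠ 0) (h : -(‖w‖ / 2) ≤ w.re) : w ∈ Complex.slitPlane := by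
  rw [Complex.mem_slitPlane_iff]
  by_contra hcon
  push Not at hcon
  obtain ⟨h1, h2⟩ := hcon
  have : ‖w‖ = |w.re| := by
    rw [← Complex.re_add_im w, h2]; simp
  rw [abs_of_nonpos h1] at this
  have h3 : w.re = 0 := by linarith
  exact h0 (Complex.ext (by simpa using h3) (by simpa using h2))

lemma seg (w : ℂ) (X s : ℝ) (hX : ‖w‖ ≤ X) (h : -(‖w‖ / 2) ≤ w.re) (hs : s ∈ Icc (0:ℝ) 1) :
    let v : ℂ := (X:ℂ) + s * (w - X);
    -(‖v‖ / 2) ≤ v.re ∧ ‖w‖ / 2 ≤ ‖v‖ := by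
  intro v
  obtain ⟨h0, h1⟩ := hs
  have hn := norm_nonneg w
  have hvre : v.re = (1 - s) * X + s * w.re := by simp [v]; ring
  have hvim : v.im = s * w.im := by simp [v]
  have hsq : ‖v‖ ^ 2 = v.re ^ 2 + v.im ^ 2 := by
    rw [Complex.sq_norm, Complex.normSq_apply]; ring
  have hwsq : ‖w‖ ^ 2 = w.re ^ 2 + w.im ^ 2 := by
    rw [Complex.sq_norm, Complex.normSq_apply]; ring
  have hb : 0 ≤ (1 - s) * X := mul_nonneg (by linarith) (by linarith)
  have ha : 0 ≤ s * ‖w‖ := by positivity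
  constructor
  · have : s * ‖w‖ - (1 - s) * X ≤ ‖v‖ := by
      have h2 : ((s:ℂ) * w) - (-(((1 - s) * X : ℝ) : ℂ)) = v := by simp only [v]; push_cast; ring
      have h3 := norm_sub_norm_le ((s:ℂ) * w) (-(((1 - s) * X : ℝ) : ℂ))
      rw [h2, norm_neg, Complex.norm_real, Real.norm_of_nonneg hb, norm_mul, Complex.norm_real,
        Real.norm_of_nonneg h0] at h3
      exact h3
    rw [hvre]
    nlinarith [mul_le_mul_of_nonneg_left h h0]
  · apply (pow_le_pow_iff_left₀ (by positivity) (norm_nonneg v) two_ne_zero).1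
    rw [hsq, hvre, hvim]
    have h5 : ‖w‖ ≤ s * ‖w‖ + (1 - s) * X := by nlinarith
    have h6 : ‖w‖ ^ 2 ≤ (s * ‖w‖ + (1 - s) * X) ^ 2 := by gcongr
    have h7 : ((1 - s) * X) * (s * w.re) ≥ -(((1 - s) * X) * (s * ‖w‖) / 2) := by
      have := mul_le_mul_of_nonneg_left (mul_le_mul_of_nonneg_left h h0) hb
      linarith
    have h8 : s ^ 2 * ‖w‖ ^ 2 = s ^ 2 * w.re ^ 2 + s ^ 2 * w.im ^ 2 := by rw [hwsq]; ring
    nlinarith [sq_nonneg (s * ‖w‖ - (1 - s) * X)]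

lemma pathA (P Q : Polynomial ℂ) (hP : P ≠ 0) (hq : 1 ≤ Q.natDegree) (f : ℂ → ℂ)
    (hf : ∀ z, HasDerivAt f (P.eval z * Complex.exp (Q.eval z)) z) (τ : ℂ)
    (hτ : Q.leadingCoeff * τ ^ Q.natDegree = -1) (e : ℝ) (he : 0 < e) (he' : e ≤ 1 / 12) :
    ∃ R : ℝ, 0 < R ∧ ∀ (w : ℂ) (X : ℝ), R ≤ ‖w‖ → ‖w‖ ≤ X → -(‖w‖ / 2) ≤ w.re →
      ‖(X:ℂ) - w‖ / 3 ≤ X - w.re →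
      ‖(f (zeta Q.natDegree τ w) - L P Q (zeta Q.natDegree τ w))
        - (f (zeta Q.natDegree τ X) - L P Q (zeta Q.natDegree τ X))‖
          ≤ 10 * e * ‖L P Q (zeta Q.natDegree τ w)‖ ∧
      ‖L P Q (zeta Q.natDegree τ X)‖ * Real.exp (‖(X:ℂ) - w‖ / 20)
        ≤ ‖L P Q (zeta Q.natDegree τ w)‖ := by
  set c := Q.leadingCoeff with hc
  set q := Q.natDegree with hqd
  have hτ0 : τ ≠ 0 := by
    rintro rfl
    rw [zero_pow (by omega)] at hτ
    simp at hτ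
  have hq0 : (q:ℂ) ≠ 0 := by exact_mod_cast (by omega : q ≠ 0)
  have hτn := norm_pos_iff.2 hτ0
  obtain ⟨R₀, hR₀, hR⟩ := exists_radius P Q hP hq e he
  refine ⟨2 * (R₀ ^ q / ‖τ‖ ^ q), by positivity, ?_⟩
  intro w X hw hX hre hdir
  have hv : ∀ s ∈ Icc (0:ℝ) 1, -(‖(X:ℂ) + s * (w - X)‖ / 2) ≤ ((X:ℂ) + s * (w - X)).re ∧
      ‖w‖ / 2 ≤ ‖(X:ℂ) + s * (w - X)‖ := fun s hs => seg w X s hX hre hs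
  have hv0 : ∀ s ∈ Icc (0:ℝ) 1, (X:ℂ) + s * (w - X) ≠ 0 := by
    intro s hs
    have h1 : 0 < R₀ ^ q / ‖τ‖ ^ q := by positivity
    exact norm_pos_iff.1 (by linarith [(hv s hs).2])
  have hslit : ∀ s ∈ Icc (0:ℝ) 1, (X:ℂ) + s * (w - X) ∈ Complex.slitPlane :=
    fun s hs => slit_of _ (hv0 s hs) (hv s hs).1
  have hbig : ∀ s ∈ Icc (0:ℝ) 1, R₀ ≤ ‖zeta q τ ((X:ℂ) + s * (w - X))‖ := by
    intro s hs
    apply (pow_le_pow_iff_left₀ (by linarith) (norm_nonneg _) (by omega : q ≠ 0)).1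
    rw [← norm_pow, zeta_pow q hq _ _ (hv0 s hs), norm_mul, norm_pow]
    have : R₀ ^ q / ‖τ‖ ^ q ≤ ‖(X:ℂ) + s * (w - X)‖ := by linarith [(hv s hs).2]
    rw [div_le_iff₀ (by positivity)] at this
    linarith
  have hy : ∀ s ∈ Icc (0:ℝ) 1,
      ‖((w - X) * (zeta q τ ((X:ℂ) + s * (w - X)) / (q * ((X:ℂ) + s * (w - X))))) *
        Q.derivative.eval (zeta q τ ((X:ℂ) + s * (w - X))) - (X - w)‖ ≤ 1 / 12 * ‖(X:ℂ) - w‖ := by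
    intro s hs
    obtain ⟨-, -, -, h⟩ := hR _ (hbig s hs)
    rw [← hc, ← hqd, zeta_pow q hq _ _ (hv0 s hs), ← mul_assoc c, hτ] at h
    have h0 := hv0 s hs
    set v := (X:ℂ) + s * (w - X)
    set D := Q.derivative.eval (zeta q τ v)
    have e1 : ((w - X) * (zeta q τ v / (q * v))) * D - (X - w)
        = (w - X) * ((zeta q τ v * D - q * (-1 * v)) / (q * v)) := by
      field_simp; ring
    rw [e1, norm_mul, norm_div, norm_sub_rev w, mul_comm (1/12)]
    refine mul_le_mul_of_nonneg_left ?_ (norm_nonneg _)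
    rw [div_le_iff₀ (norm_pos_iff.2 (mul_ne_zero hq0 h0))]
    have e2 : ‖(q:ℂ) * (-1 * v)‖ = ‖(q:ℂ) * v‖ := by
      rw [← norm_neg]; congr 1; ring
    rw [e2] at h
    exact h.trans (by gcongr)
  have := path P Q f hf (fun s => zeta q τ ((X:ℂ) + s * (w - X)))
    (fun s => (w - X) * (zeta q τ ((X:ℂ) + s * (w - X)) / (q * ((X:ℂ) + s * (w - X))))) e (1/5)
    (by norm_num) (by linarith) ?_ (fun s hs => (hR _ (hbig s hs)).1)
    (fun s hs => (hR _ (hbig s hs)).2.1) (fun s hs => (hR _ (hbig s hs)).2.2.1) ?_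
  · obtain ⟨h1, h2⟩ := this
    have h2 := h2 (‖(X:ℂ) - w‖ / 20) ?_
    · have e1 : (X:ℂ) + ((1:ℝ):ℂ) * (w - X) = w := by push_cast; ring
      have e0 : (X:ℂ) + ((0:ℝ):ℂ) * (w - X) = X := by push_cast; ring
      simp only [e0, e1] at h1 h2
      refine ⟨h1.trans (le_of_eq ?_), h2⟩
      ring
    · intro s hs
      have h1 := hy s hs
      set y := ((w - X) * (zeta q τ ((X:ℂ) + s * (w - X)) / (q * ((X:ℂ) + s * (w - X))))) *
        Q.derivative.eval (zeta q τ ((X:ℂ) + s * (w - X)))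
      have h3 := norm_sub_norm_le ((X:ℂ) - w) y
      rw [norm_sub_rev _ y] at h3
      have := norm_nonneg ((X:ℂ) - w)
      linarith
  · intro s hs
    have h1 : HasDerivAt (fun s : ℝ => (X:ℂ) + s * (w - X)) (w - X) s := by
      have := ((Complex.ofRealCLM.hasDerivAt (x := s)).mul_const (w - (X:ℂ))).const_add (X:ℂ)
      refine HasDerivAt.congr_deriv this ?_
      simp
    exact HasDerivAt.scomp (g₁ := zeta q τ) s (hasDerivAt_zeta q τ _ (hslit s hs)) h1
  · intro s hs
    have h1 := hy s hs
    set y := ((w - X) * (zeta q τ ((X:ℂ) + s * (w - X)) / (q * ((X:ℂ) + s * (w - X))))) *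
      Q.derivative.eval (zeta q τ ((X:ℂ) + s * (w - X)))
    have h2 := (abs_le.1 (Complex.abs_re_le_norm (y - (X - w)))).1
    have h3 := norm_sub_norm_le y ((X:ℂ) - w)
    simp only [Complex.sub_re, Complex.ofReal_re] at h2
    have := norm_nonneg ((X:ℂ) - w)
    linarith

lemma exists_limit (P Q : Polynomial ℂ) (hP : P ≠ 0) (hq : 1 ≤ Q.natDegree) (f : ℂ → ℂ)
    (hf : ∀ z, HasDerivAt f (P.eval z * Complex.exp (Q.eval z)) z) (τ : ℂ)
    (hτ : Q.leadingCoeff * τ ^ Q.natDegree = -1) :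
    ∃ a : ℂ, ∀ ε : ℝ, 0 < ε → ∃ R : ℝ, 0 < R ∧ ∀ w : ℂ, R ≤ ‖w‖ → -(‖w‖ / 2) ≤ w.re →
      ‖f (zeta Q.natDegree τ w) - a - L P Q (zeta Q.natDegree τ w)‖
        ≤ ε * ‖L P Q (zeta Q.natDegree τ w)‖ := by
  set q := Q.natDegree
  obtain ⟨R, hR0, hR⟩ := pathA P Q hP hq f hf τ hτ (1/12) (by norm_num) le_rfl
  have hreal : ∀ x X : ℝ, R ≤ x → x ≤ X →
      ‖(f (zeta q τ x) - L P Q (zeta q τ x)) - (f (zeta q τ X) - L P Q (zeta q τ X))‖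
          ≤ ‖L P Q (zeta q τ x)‖ ∧
      ‖L P Q (zeta q τ X)‖ * Real.exp ((X - x) / 20) ≤ ‖L P Q (zeta q τ x)‖ := by
    intro x X hx hX
    have hx0 : 0 ≤ x := by linarith
    have hn : ‖(x:ℂ)‖ = x := by rw [Complex.norm_real, Real.norm_of_nonneg hx0]
    have hn2 : ‖(X:ℂ) - x‖ = X - x := by
      rw [← Complex.ofReal_sub, Complex.norm_real, Real.norm_of_nonneg (by linarith)]
    have := hR x X (by rwa [hn]) (by rwa [hn]) (by rw [hn, Complex.ofReal_re]; linarith)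
      (by rw [hn2, Complex.ofReal_re]; linarith)
    rw [hn2] at this
    refine ⟨this.1.trans ?_, this.2⟩
    have := norm_nonneg (L P Q (zeta q τ x))
    linarith
  have hL : Tendsto (fun X : ℝ => ‖L P Q (zeta q τ X)‖) atTop (nhds 0) := by
    have h1 : Tendsto (fun X : ℝ => ‖L P Q (zeta q τ R)‖ * Real.exp (-((X - R) / 20))) atTop
        (nhds 0) := by
      rw [← mul_zero ‖L P Q (zeta q τ R)‖]
      apply Tendsto.const_mul
      apply Real.tendsto_exp_neg_atTop_nhds_zero.comp
      exact (tendsto_atTop_add_const_right _ (-R) tendsto_id).atTop_div_const (by norm_num)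
    refine squeeze_zero' (Eventually.of_forall fun _ => norm_nonneg _) ?_ h1
    filter_upwards [eventually_ge_atTop R] with X hX
    have := (hreal R X le_rfl hX).2
    rw [Real.exp_neg, ← div_eq_mul_inv, le_div_iff₀ (Real.exp_pos _)]
    exact this
  have hC : CauchySeq (fun X : ℝ => f (zeta q τ X) - L P Q (zeta q τ X)) := by
    rw [Metric.cauchySeq_iff']
    intro ε hε
    obtain ⟨N, hN1, hN2⟩ := ((hL.eventually_lt_const hε).and (eventually_ge_atTop R)).exists
    refine ⟨N, fun X hX => ?_⟩
    rw [dist_comm, dist_eq_norm]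
    exact (hreal N X hN2 hX).1.trans_lt hN1
  obtain ⟨a, ha⟩ := cauchySeq_tendsto_of_complete hC
  refine ⟨a, fun ε hε => ?_⟩
  obtain ⟨R', hR'0, hR'⟩ := pathA P Q hP hq f hf τ hτ (min (1/12) (ε / 10)) (by positivity)
    (min_le_left _ _)
  refine ⟨R', hR'0, fun w hw hre => ?_⟩
  have h1 : Tendsto (fun X : ℝ => ‖(f (zeta q τ w) - L P Q (zeta q τ w))
      - (f (zeta q τ X) - L P Q (zeta q τ X))‖) atTop
      (nhds ‖(f (zeta q τ w) - L P Q (zeta q τ w)) - a‖) := (tendsto_const_nhds.sub ha).norm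
  have h2 := le_of_tendsto (b := ε * ‖L P Q (zeta q τ w)‖) h1 ?_
  · rwa [sub_right_comm] at h2
  · filter_upwards [eventually_ge_atTop (2 * ‖w‖)] with X hX
    have hn := norm_nonneg w
    have hre' := Complex.re_le_norm w
    have hn2 : ‖(X:ℂ) - w‖ ≤ X + ‖w‖ := by
      have := norm_sub_le (X:ℂ) w
      rwa [Complex.norm_real, Real.norm_of_nonneg (by linarith)] at this
    refine (hR' w X hw (by linarith) hre (by linarith)).1.trans ?_
    have := min_le_right (1/12) (ε / 10)
    have h3 : 10 * min (1/12) (ε / 10) ≤ ε := by linarith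
    gcongr

lemma log_contra (H : ℝ → ℂ) (t₀ : ℝ) (hc : ContinuousOn H (Ici t₀))
    (hH : Tendsto (fun t => ‖H t‖) atTop atTop) (B : ℂ) (hB : B ≠ 0)
    (hexp : Tendsto (fun t => Complex.exp (H t)) atTop (nhds B)) : False := by
  have h1 : Tendsto (fun t => Complex.exp (H t - Complex.log B)) atTop (nhds 1) := by
    have := hexp.div_const B
    rw [div_self hB] at this
    refine this.congr fun t => ?_
    rw [Complex.exp_sub, Complex.exp_log hB]
  have h2 : ∀ᶠ t in atTop, Complex.exp (H t - Complex.log B) ∈ Complex.slitPlane :=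
    h1.eventually (Complex.isOpen_slitPlane.mem_nhds Complex.one_mem_slitPlane)
  obtain ⟨t₁, ht₁⟩ := eventually_atTop.1 (h2.and (eventually_ge_atTop t₀))
  let D : ℝ → ℂ := fun t => (H t - Complex.log B) -
    Complex.log (Complex.exp (H t - Complex.log B))
  have hKc : ContinuousOn (fun t => H t - Complex.log B) (Ici t₁) :=
    (hc.mono fun t ht => (ht₁ t ht).2).sub continuousOn_const
  have hDc : ContinuousOn D (Ici t₁) :=
    hKc.sub ((Complex.continuous_exp.comp_continuousOn hKc).clog fun t ht => (ht₁ t ht).1)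
  have hDm : MapsTo (fun t => (D t / (2 * Real.pi * Complex.I)).re) (Ici t₁)
      (range ((↑) : ℤ → ℝ)) := by
    intro t _
    have : Complex.exp (D t) = 1 := by
      simp only [D]
      rw [Complex.exp_sub, Complex.exp_log (Complex.exp_ne_zero _), div_self (Complex.exp_ne_zero _)]
    obtain ⟨n, hn⟩ := Complex.exp_eq_one_iff.1 this
    refine ⟨n, ?_⟩
    simp only [hn]
    rw [mul_div_cancel_right₀ _ Complex.two_pi_I_ne_zero]
    simp
  have hconst : ∀ t ∈ Ici t₁, D t = D t₁ := by
    intro t ht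
    have hd : IsDiscrete (range ((↑) : ℤ → ℝ)) :=
      Int.isClosedEmbedding_coe_real.isInducing.isDiscrete_range
    have h3 : (D t / (2 * Real.pi * Complex.I)).re = (D t₁ / (2 * Real.pi * Complex.I)).re :=
      isPreconnected_Ici.constant_of_mapsTo hd
      (Complex.continuous_re.comp_continuousOn (hDc.div_const (2 * Real.pi * Complex.I))) hDm ht
      (self_mem_Ici (a := t₁))
    have hex : ∀ s, Complex.exp (D s) = 1 := by
      intro s
      simp only [D]
      rw [Complex.exp_sub, Complex.exp_log (Complex.exp_ne_zero _), div_self (Complex.exp_ne_zero _)]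
    obtain ⟨n, hn⟩ := Complex.exp_eq_one_iff.1 (hex t)
    obtain ⟨k, hk⟩ := Complex.exp_eq_one_iff.1 (hex t₁)
    rw [hn, hk, mul_div_cancel_right₀ _ Complex.two_pi_I_ne_zero,
      mul_div_cancel_right₀ _ Complex.two_pi_I_ne_zero] at h3
    simp only [Complex.intCast_re, Int.cast_inj] at h3
    rw [hn, hk, h3]
  have hlim : Tendsto H atTop (nhds (D t₁ + Complex.log 1 + Complex.log B)) := by
    have h4 := ((h1.clog Complex.one_mem_slitPlane).const_add (D t₁)).add_const (Complex.log B)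
    refine h4.congr' ?_
    filter_upwards [eventually_ge_atTop t₁] with t ht
    rw [← hconst t ht]
    simp only [D]; ring
  exact not_tendsto_nhds_of_tendsto_atTop hH _ hlim.norm

lemma final_contra (P Q : Polynomial ℂ) (hP : P ≠ 0) (hq : 1 ≤ Q.natDegree) (γ w : ℝ → ℂ)
    (hγc : Continuous γ) (hγ : Tendsto (fun t => ‖γ t‖) atTop atTop) (t₀ : ℝ) (τ : ℂ) (hτ : τ ≠ 0)
    (hw : ∀ t, w t = -(Q.leadingCoeff * γ t ^ Q.natDegree))
    (hslit : ∀ t ∈ Ici t₀, w t ∈ Complex.slitPlane)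
    (hz : ∀ t ∈ Ici t₀, γ t = zeta Q.natDegree τ (w t)) (A : ℂ) (hA : A ≠ 0)
    (hL : Tendsto (fun t => L P Q (γ t)) atTop (nhds A)) : False := by
  have hQ0 := derivative_ne Q hq
  have hQ : Q ≠ 0 := by rintro rfl; simp at hq
  have hγ' : Tendsto γ atTop (cobounded ℂ) := tendsto_norm_atTop_iff_cobounded.1 hγ
  set q := Q.natDegree with hqd
  set c := Q.leadingCoeff with hc
  have hc0 : c ≠ 0 := Polynomial.leadingCoeff_ne_zero.2 hQ
  have hwc : Continuous w := by
    have : w = fun t => -(c * γ t ^ q) := funext hw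
    rw [this]; fun_prop
  set l : ℝ → ℂ := fun t => Complex.log (w t) / q with hl
  have hlc : ContinuousOn l (Ici t₀) := (hwc.continuousOn.clog hslit).div_const _
  set d := Q.derivative.natDegree
  set p := P.natDegree
  have hne : ∀ᶠ z : ℂ in cobounded ℂ, z ≠ 0 := by
    filter_upwards [tendsto_norm_cobounded_atTop.eventually_gt_atTop (0:ℝ)] with z hz
    exact norm_pos_iff.1 hz
  have r1 : Tendsto (fun t => Q.derivative.eval (γ t) /
      (Q.derivative.leadingCoeff * γ t ^ d)) atTop (nhds 1) := by
    have h := Polynomial.isEquivalent_cobounded_leading_monomial (P := Q.derivative)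
    rw [isEquivalent_iff_tendsto_one] at h
    · exact h.comp hγ'
    · filter_upwards [hne] with z hz
      exact mul_ne_zero (Polynomial.leadingCoeff_ne_zero.2 hQ0) (pow_ne_zero _ hz)
  have r2 : Tendsto (fun t => (P.leadingCoeff * γ t ^ p) / P.eval (γ t)) atTop (nhds 1) := by
    have h := (Polynomial.isEquivalent_cobounded_leading_monomial (P := P)).symm
    rw [isEquivalent_iff_tendsto_one (eventually_ne P hP)] at h
    exact h.comp hγ'
  set m : ℂ := (p:ℂ) - d with hm
  let k : ℂ := Q.derivative.leadingCoeff / P.leadingCoeff * (τ ^ d / τ ^ p)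
  have hk : k ≠ 0 := mul_ne_zero (div_ne_zero (Polynomial.leadingCoeff_ne_zero.2 hQ0)
    (Polynomial.leadingCoeff_ne_zero.2 hP)) (div_ne_zero (pow_ne_zero _ hτ) (pow_ne_zero _ hτ))
  refine log_contra (fun t => Q.eval (γ t) + m * l t) t₀ ?_ ?_ (A * 1 * 1 * k)
    (by simp [hA, hk]) ?_
  · exact (Q.continuous.comp hγc).continuousOn.add (continuousOn_const.mul hlc)
  · have hwn : Tendsto (fun t => ‖w t‖) atTop atTop := by
      have h1 := ((tendsto_pow_atTop (by omega : q ≠ 0)).comp hγ).const_mul_atTop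
        (norm_pos_iff.2 hc0)
      refine h1.congr fun t => ?_
      rw [hw]; simp
    have hQn : ∀ᶠ t in atTop, ‖w t‖ / 2 ≤ ‖Q.eval (γ t)‖ := by
      have h := (Polynomial.isEquivalent_cobounded_leading_monomial (P := Q)).isLittleO.bound
        (c := 1/2) (by norm_num)
      filter_upwards [hγ'.eventually h] with t ht
      simp only [Pi.sub_apply] at ht
      rw [← hqd, ← hc] at ht
      have h3 := norm_sub_norm_le (c * γ t ^ q) (Q.eval (γ t))
      rw [norm_sub_rev] at h3
      rw [hw, norm_neg]
      linarith
    have hlog : ∀ᶠ t in atTop, ‖m / q‖ * Real.log ‖w t‖ ≤ ‖w t‖ / 4 := by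
      have h := (Real.isLittleO_log_id_atTop.const_mul_left ‖m / q‖).bound
        (c := 1/4) (by norm_num)
      filter_upwards [hwn.eventually h, hwn.eventually_ge_atTop 0] with t ht h0
      have := (le_abs_self _).trans ht
      simp only [id, Real.norm_of_nonneg h0] at this
      linarith
    have hbase : Tendsto (fun t => ‖w t‖ * (1/4) + -(‖m / q‖ * Real.pi)) atTop atTop :=
      tendsto_atTop_add_const_right _ _ (hwn.atTop_mul_const (by norm_num))
    refine tendsto_atTop_mono' _ ?_ hbase
    filter_upwards [hQn, hlog, hwn.eventually_ge_atTop 1] with t h1 h2 h3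
    have h4 : ‖Complex.log (w t)‖ ≤ Real.log ‖w t‖ + Real.pi := by
      have := Complex.norm_le_abs_re_add_abs_im (Complex.log (w t))
      rw [Complex.log_re, Complex.log_im, abs_of_nonneg (Real.log_nonneg h3)] at this
      linarith [Complex.abs_arg_le_pi (w t)]
    have h5 : ‖m * l t‖ ≤ ‖m / q‖ * (Real.log ‖w t‖ + Real.pi) := by
      have : m * l t = m / q * Complex.log (w t) := by simp only [hl]; ring
      rw [this, norm_mul]; gcongr
    have h6 := norm_sub_norm_le (Q.eval (γ t)) (-(m * l t))
    rw [norm_neg, sub_neg_eq_add] at h6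
    linarith
  · have h := ((hL.mul r1).mul r2).mul_const k
    refine h.congr' ?_
    filter_upwards [eventually_ge_atTop t₀, hγ'.eventually hne,
      hγ'.eventually (eventually_ne P hP), hγ'.eventually (eventually_ne _ hQ0)] with t h0 h1 h2 h3
    have hg : γ t = τ * Complex.exp (l t) := hz t h0
    have e1 : Complex.exp (Q.eval (γ t) + m * l t) = Complex.exp (Q.eval (γ t)) *
        (Complex.exp (l t) ^ p / Complex.exp (l t) ^ d) := by
      rw [Complex.exp_add, hm, sub_mul, Complex.exp_sub, Complex.exp_nat_mul, Complex.exp_nat_mul]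
    have e2 : Complex.exp (l t) = γ t / τ := by rw [hg]; field_simp
    rw [e1, e2]
    have hlP := Polynomial.leadingCoeff_ne_zero.2 hP
    have hlQ := Polynomial.leadingCoeff_ne_zero.2 hQ0
    simp only [L, k, div_pow]
    field_simp

lemma main_aux (P Q : Polynomial ℂ) (hP : P ≠ 0) (hq : 1 ≤ Q.natDegree) (f : ℂ → ℂ)
    (hf : ∀ z, HasDerivAt f (P.eval z * Complex.exp (Q.eval z)) z) :
    ∃ F : ℂ → ℂ, {a : ℂ | AsymptoticValue f a} ⊆
      Set.image F {τ : ℂ | τ ^ Q.natDegree = -1 / Q.leadingCoeff} := by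
  have hQ : Q ≠ 0 := by rintro rfl; simp at hq
  have hc0 : Q.leadingCoeff ≠ 0 := Polynomial.leadingCoeff_ne_zero.2 hQ
  have hlim := fun (τ : ℂ) (hτ : Q.leadingCoeff * τ ^ Q.natDegree = -1) =>
    exists_limit P Q hP hq f hf τ hτ
  have hlim' : ∀ τ : ℂ, ∃ a : ℂ, Q.leadingCoeff * τ ^ Q.natDegree = -1 →
      ∀ ε : ℝ, 0 < ε → ∃ R : ℝ, 0 < R ∧ ∀ w : ℂ, R ≤ ‖w‖ → -(‖w‖ / 2) ≤ w.re →
      ‖f (zeta Q.natDegree τ w) - a - L P Q (zeta Q.natDegree τ w)‖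
        ≤ ε * ‖L P Q (zeta Q.natDegree τ w)‖ := by
    intro τ
    by_cases h : Q.leadingCoeff * τ ^ Q.natDegree = -1
    · obtain ⟨a, ha⟩ := hlim τ h
      exact ⟨a, fun _ => ha⟩
    · exact ⟨0, fun h' => absurd h' h⟩
  choose F hF using hlim'
  refine ⟨F, ?_⟩
  rintro a ⟨γ, hγc, hγ, hfa⟩
  have hγ' : Tendsto γ atTop (cobounded ℂ) := tendsto_norm_atTop_iff_cobounded.1 hγ
  set q := Q.natDegree with hqd
  set c := Q.leadingCoeff with hc
  have hq0 : q ≠ 0 := by omega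
  set w : ℝ → ℂ := fun t => -(c * γ t ^ q) with hw
  have hwc : Continuous w := by fun_prop
  have hwn : Tendsto (fun t => ‖w t‖) atTop atTop := by
    have h1 := ((tendsto_pow_atTop hq0).comp hγ).const_mul_atTop (norm_pos_iff.2 hc0)
    refine h1.congr fun t => ?_
    simp [hw]
  -- eventually outside the growth sectors
  have hev : ∀ᶠ t in atTop, -(‖w t‖ / 2) ≤ (w t).re := by
    have hB := tendsto_B P Q hP hq f hf
    have h1 := hB.eventually_gt_atTop (‖a‖ + 1)
    rw [eventually_inf_principal] at h1
    have h2 : ∀ᶠ t in atTop, ‖f (γ t)‖ < ‖a‖ + 1 :=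
      hfa.norm.eventually_lt_const (by linarith)
    filter_upwards [hγ'.eventually h1, h2] with t h3 h4
    by_contra hcon
    push Not at hcon
    simp only [hw, norm_neg, Complex.neg_re] at hcon
    have := h3 (by
      change ‖c * γ t ^ q‖ / 2 ≤ (c * γ t ^ q).re
      linarith)
    linarith
  obtain ⟨t₀, ht₀⟩ := eventually_atTop.1 (hev.and (hwn.eventually_gt_atTop 0))
  have hw0 : ∀ t ∈ Ici t₀, w t ≠ 0 := fun t ht => norm_pos_iff.1 (ht₀ t ht).2
  have hslit : ∀ t ∈ Ici t₀, w t ∈ Complex.slitPlane := fun t ht =>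
    slit_of _ (hw0 t ht) (ht₀ t ht).1
  let T : ℝ → ℂ := fun t => γ t / Complex.exp (Complex.log (w t) / q)
  have hTc : ContinuousOn T (Ici t₀) := hγc.continuousOn.div
    (Complex.continuous_exp.comp_continuousOn ((hwc.continuousOn.clog hslit).div_const _))
    fun t _ => Complex.exp_ne_zero _
  have hTq : ∀ t ∈ Ici t₀, T t ^ q = -1 / c := by
    intro t ht
    simp only [T]
    rw [div_pow, ← Complex.exp_nat_mul, mul_div_cancel₀ _ (by exact_mod_cast hq0),
      Complex.exp_log (hw0 t ht)]
    have : γ t ^ q ≠ 0 := by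
      have := hw0 t ht
      simp only [hw] at this
      intro h0
      simp [h0] at this
    simp only [hw]
    field_simp
  have hfin : {τ : ℂ | τ ^ q = -1 / c}.Finite := by
    refine (Polynomial.nthRoots q (-1 / c)).toFinset.finite_toSet.subset ?_
    intro τ hτ
    simpa [Polynomial.mem_nthRoots (Nat.pos_of_ne_zero hq0)] using hτ
  have hconst : ∀ t ∈ Ici t₀, T t = T t₀ := fun t ht =>
    isPreconnected_Ici.constant_of_mapsTo hfin.isDiscrete hTc (fun s hs => hTq s hs) ht
      (self_mem_Ici (a := t₀))
  set τ := T t₀ with hτd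
  have hτq : τ ^ q = -1 / c := hTq t₀ (self_mem_Ici)
  have hτ1 : c * τ ^ q = -1 := by rw [hτq]; field_simp
  have hτ0 : τ ≠ 0 := by
    intro h0
    rw [h0, zero_pow hq0] at hτ1
    simp at hτ1
  have hz : ∀ t ∈ Ici t₀, γ t = zeta q τ (w t) := by
    intro t ht
    rw [← hconst t ht]
    simp only [zeta, T]
    rw [div_mul_cancel₀ _ (Complex.exp_ne_zero _)]
  refine ⟨τ, hτq, ?_⟩
  by_contra hne
  have hA : a - F τ ≠ 0 := sub_ne_zero.2 (Ne.symm hne)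
  refine final_contra P Q hP hq γ w hγc hγ t₀ τ hτ0 (fun t => rfl) hslit hz (a - F τ) hA ?_
  have happ : ∀ ε : ℝ, 0 < ε → ∀ᶠ t in atTop,
      ‖f (γ t) - F τ - L P Q (γ t)‖ ≤ ε * ‖L P Q (γ t)‖ := by
    intro ε hε
    obtain ⟨R, -, hR⟩ := hF τ hτ1 ε hε
    filter_upwards [hwn.eventually_ge_atTop R, eventually_ge_atTop t₀] with t h1 h2
    have := hR (w t) h1 (ht₀ t h2).1
    rwa [← hz t h2] at this
  have hfF : Tendsto (fun t => f (γ t) - F τ) atTop (nhds (a - F τ)) := hfa.sub_const _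
  have hequiv : (fun t => f (γ t) - F τ) ~[atTop] (fun t => L P Q (γ t)) := by
    refine IsLittleO.of_bound fun ε hε => ?_
    exact happ ε hε
  exact hequiv.tendsto_nhds hfF

end AsymVal

/-- A structurally finite entire function `f(z) = b + ∫₀^z P(t) e^{Q(t)} dt` of type `(p,q)`
has at most `q` finite asymptotic values. -/
theorem asymptotic_values_structurally_finite
    (P Q : Polynomial ℂ) (p q : ℕ) (hP : P.natDegree = p) (hP0 : P ≠ 0)
    (hQ : Q.natDegree = q) (hq : 1 ≤ q) (b : ℂ) (f : ℂ → ℂ)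
    (hf : f = fun z => b + lineIntegral (fun t => P.eval t * Complex.exp (Q.eval t)) z) :
    {a : ℂ | AsymptoticValue f a}.Finite ∧ {a : ℂ | AsymptoticValue f a}.ncard ≤ q := by
  subst hQ
  have hder : ∀ z, HasDerivAt f (P.eval z * Complex.exp (Q.eval z)) z := by
    intro z
    rw [hf]
    exact (AsymVal.hasDerivAt_lineIntegral _ (P.differentiable.mul Q.differentiable.cexp) z).const_add b
  obtain ⟨F, hF⟩ := AsymVal.main_aux P Q hP0 hq f hder
  have hsub : {τ : ℂ | τ ^ Q.natDegree = -1 / Q.leadingCoeff} ⊆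
      ((Polynomial.nthRoots Q.natDegree (-1 / Q.leadingCoeff)).toFinset : Set ℂ) := by
    intro τ hτ
    simpa [Polynomial.mem_nthRoots (show 0 < Q.natDegree by omega)] using hτ
  have hsub2 := hF.trans (image_mono hsub)
  have hfin := (Finset.finite_toSet
    (Polynomial.nthRoots Q.natDegree (-1 / Q.leadingCoeff)).toFinset).image F
  refine ⟨hfin.subset hsub2, ?_⟩
  calc _ ≤ _ := Set.ncard_le_ncard hsub2 hfin
    _ ≤ _ := Set.ncard_image_le (Finset.finite_toSet _)
    _ = _ := Set.ncard_coe_finset _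
    _ ≤ _ := Multiset.toFinset_card_le _
    _ ≤ _ := Polynomial.card_nthRoots _ _
end

section
/- Let f be a nonconstant entire function with only finitely many critical points and only finitely many finite asymptotic values. Let X ⊆ ℂ be a bounded, open, connected, simply connected set, let a ∈ X, and suppose that X ∖ {a} contains no critical value of f and no finite asymptotic value of f. Let y₀ ∈ ℂ satisfy f(y₀) = a and f'(y₀) ≠ 0, and let Y be the connected component of f⁻¹(X) containing y₀. Then f restricted to Y is a bijection (hence a biholomorphism) from Y onto X; in particular, y₀ is the unique point of Y mapped to a. -/
open Metric Set Function Filter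

section AuxLemmas

open scoped Topology

theorem aux_lift_path {E B : Type*} [TopologicalSpace E] [TopologicalSpace B] [T2Space E]
    [T2Space B]
    {p : E → B} (hp : IsLocalHomeomorph p) (c : ℝ → B) (hc : Continuous c) (e₀ : E)
    (h0 : p e₀ = c 0)
    (H : ∀ t ∈ Ioc (0:ℝ) 1, ∀ Γ : ℝ → E, ContinuousOn Γ (Ico 0 t) → EqOn (p ∘ Γ) c (Ico 0 t) →
      ∃ e, Tendsto Γ (𝓝[<] t) (𝓝 e)) :
    ∃ Γ : ℝ → E, ContinuousOn Γ (Icc 0 1) ∧ EqOn (p ∘ Γ) c (Icc 0 1) ∧ Γ 0 = e₀ := by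
  let P : ℝ → (ℝ → E) → Prop := fun t Γ =>
    ContinuousOn Γ (Icc 0 t) ∧ EqOn (p ∘ Γ) c (Icc 0 t) ∧ Γ 0 = e₀
  have huniq : ∀ t Γ Γ', 0 ≤ t → P t Γ → P t Γ' → EqOn Γ Γ' (Icc 0 t) := by
    intro t Γ Γ' ht h h'
    exact (T2Space.isSeparatedMap p).eqOn_of_comp_eqOn hp.isLocallyInjective isPreconnected_Icc
      h.1 h'.1 (h.2.1.trans h'.2.1.symm) (left_mem_Icc.2 ht) (h.2.2.trans h'.2.2.symm)
  have hmono : ∀ s t Γ, s ≤ t → P t Γ → P s Γ := fun s t Γ hst h =>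
    ⟨h.1.mono (Icc_subset_Icc_right hst), h.2.1.mono (Icc_subset_Icc_right hst), h.2.2⟩
  let S : Set ℝ := {t | ∃ Γ, P t Γ}
  have hS0 : (0:ℝ) ∈ S := by
    refine ⟨fun _ => e₀, continuousOn_const, ?_, rfl⟩
    intro s hs
    have : s = 0 := le_antisymm hs.2 hs.1
    simp [this, h0]
  -- extension past t
  have hright : ∀ t, 0 ≤ t → t ∈ S → ∃ u > t, u ∈ S := by
    rintro t ht ⟨Γ, hΓ⟩
    obtain ⟨q, hq, hpq⟩ := hp (Γ t)
    have hct : c t ∈ q.target := by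
      have := hΓ.2.1 (right_mem_Icc.2 ht)
      simp only [comp_apply] at this
      rw [← this, hpq]
      exact q.map_source hq
    have : ∀ᶠ s in 𝓝 t, c s ∈ q.target := hc.continuousAt.eventually (q.open_target.mem_nhds hct)
    obtain ⟨δ, hδ, hball⟩ := Metric.eventually_nhds_iff.1 this
    have htgt : ∀ s ∈ Icc t (t + δ/2), c s ∈ q.target := by
      intro s hs
      apply hball
      rw [Real.dist_eq, abs_lt]
      constructor <;> linarith [hs.1, hs.2]
    have hqt : q.symm (c t) = Γ t := by
      have := hΓ.2.1 (right_mem_Icc.2 ht)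
      simp only [comp_apply] at this
      rw [← this, hpq, q.left_inv hq]
    refine ⟨t + δ/2, by linarith, fun s => if s ≤ t then Γ s else q.symm (c s), ?_, ?_, ?_⟩
    · apply ContinuousOn.if
      · rintro s ⟨hs, hf⟩
        have : s = t := by simpa using frontier_le_subset_eq continuous_id continuous_const hf
        rw [this, hqt]
      · refine hΓ.1.mono ?_
        rintro s ⟨hs, hf⟩
        rw [show {a : ℝ | a ≤ t} = Iic t from rfl, closure_Iic] at hf
        exact ⟨hs.1, hf⟩
      · refine (q.continuousOn_symm.comp hc.continuousOn (s := Icc t (t+δ/2)) htgt).mono ?_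
        rintro s ⟨hs, hf⟩
        have : t ≤ s := closure_lt_subset_le continuous_const continuous_id (by simpa using hf)
        exact ⟨this, hs.2⟩
    · intro s hs
      by_cases h : s ≤ t
      · simpa [h] using hΓ.2.1 ⟨hs.1, h⟩
      · simp only [comp_apply, h, if_false]
        rw [hpq, q.right_inv (htgt s ⟨by linarith, hs.2⟩)]
    · simp [ht, hΓ.2.2]
  -- closedness
  have hleft : ∀ t ∈ Ioc (0:ℝ) 1, (∀ s ∈ Ico 0 t, s ∈ S) → t ∈ S := by
    intro t ht hs
    have : ∀ s, ∃ Γ, s ∈ Ico 0 t → P s Γ := by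
      intro s
      by_cases h : s ∈ Ico 0 t
      · obtain ⟨Γ, h'⟩ := hs s h
        exact ⟨Γ, fun _ => h'⟩
      · exact ⟨fun _ => e₀, fun h' => absurd h' h⟩
    choose G hG using this
    let Γ : ℝ → E := fun s => G s s
    have hΓG : ∀ u ∈ Ico 0 t, EqOn Γ (G u) (Icc 0 u) := by
      intro u hu s hs
      have hs' : s ∈ Ico 0 t := ⟨hs.1, hs.2.trans_lt hu.2⟩
      exact huniq s _ _ hs.1 (hG s hs') (hmono _ _ _ hs.2 (hG u hu)) (right_mem_Icc.2 hs.1)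
    have hΓc : ContinuousOn Γ (Ico 0 t) := by
      intro s hs
      obtain ⟨u, hsu, hut⟩ := exists_between hs.2
      have hu : u ∈ Ico 0 t := ⟨hs.1.trans hsu.le, hut⟩
      have h1 : ContinuousOn Γ (Icc 0 u) := (hG u hu).1.congr (hΓG u hu)
      refine (h1 s ⟨hs.1, hsu.le⟩).mono_of_mem_nhdsWithin ?_
      rw [mem_nhdsWithin]
      exact ⟨Iio u, isOpen_Iio, hsu, fun x hx => ⟨hx.2.1, le_of_lt hx.1⟩⟩
    have hΓl : EqOn (p ∘ Γ) c (Ico 0 t) := fun s hs => (hG s hs).2.1 (right_mem_Icc.2 hs.1)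
    obtain ⟨e, he⟩ := H t ht Γ hΓc hΓl
    have hpe : p e = c t := by
      have h1 : Tendsto (p ∘ Γ) (𝓝[<] t) (𝓝 (p e)) := (hp.continuous.tendsto e).comp he
      have h2 : Tendsto c (𝓝[<] t) (𝓝 (c t)) := hc.continuousWithinAt
      refine tendsto_nhds_unique h1 (h2.congr' ?_)
      filter_upwards [Ioo_mem_nhdsLT ht.1] with s hs
      exact (hΓl ⟨hs.1.le, hs.2⟩).symm
    refine ⟨Function.update Γ t e, ?_, ?_, ?_⟩
    · rw [← Ico_insert_right ht.1.le, continuousOn_update_iff]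
      constructor
      · refine hΓc.mono ?_
        rintro x ⟨hx, hxt⟩
        rcases hx with hx | hx
        · exact absurd hx hxt
        · exact hx
      · intro _
        refine he.mono_left (nhdsWithin_mono _ ?_)
        rintro x ⟨hx, hxt⟩
        rcases hx with hx | hx
        · exact absurd hx hxt
        · exact hx.2
    · intro s hs
      rcases eq_or_lt_of_le hs.2 with rfl | h
      · simp [hpe]
      · simpa [h.ne] using hΓl ⟨hs.1, h⟩
    · rw [Function.update_of_ne ht.1.ne]
      exact (hG 0 ⟨le_rfl, ht.1⟩).2.2
  -- conclusion
  suffices (1:ℝ) ∈ S by exact this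
  by_contra h1
  have hdown : ∀ s t, s ≤ t → t ∈ S → s ∈ S := fun s t hst ⟨Γ, h⟩ => ⟨Γ, hmono _ _ _ hst h⟩
  have hub : ∀ s ∈ S, s ≤ 1 := by
    intro s hs
    by_contra hlt
    exact h1 (hdown 1 s (le_of_not_ge hlt) hs)
  have hbdd : BddAbove S := ⟨1, hub⟩
  have hT0 : 0 ≤ sSup S := le_csSup hbdd hS0
  have hTS : sSup S ∈ S := by
    rcases eq_or_lt_of_le hT0 with h | h
    · rw [← h]; exact hS0
    · refine hleft _ ⟨h, csSup_le ⟨0, hS0⟩ hub⟩ ?_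
      intro s hs
      obtain ⟨u, hu, hsu⟩ := exists_lt_of_lt_csSup ⟨0, hS0⟩ hs.2
      exact hdown _ _ hsu.le hu
  obtain ⟨u, hu, huS⟩ := hright _ hT0 hTS
  exact absurd (le_csSup hbdd huS) (not_le.2 hu)

theorem aux_localHomeo (f : ℂ → ℂ) (hf : Differentiable ℂ f) :
    IsLocalHomeomorph (fun y : {y : ℂ // deriv f y ≠ 0} => f y) := by
  have hcont : Continuous (deriv f) :=
    (hf.contDiff (n := 1)).continuous_deriv le_rfl
  have hopen : IsOpen {y : ℂ | deriv f y ≠ 0} := isOpen_ne_fun hcont continuous_const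
  have h1 : IsLocalHomeomorphOn f {y : ℂ | deriv f y ≠ 0} := by
    apply IsLocalHomeomorphOn.mk
    intro y hy
    have hs : HasStrictDerivAt f (deriv f y) y :=
      (hf.contDiff (n := 1)).contDiffAt.hasStrictDerivAt (by simp)
    exact ⟨(hs.hasStrictFDerivAt_equiv hy).toOpenPartialHomeomorph f,
      HasStrictFDerivAt.mem_toOpenPartialHomeomorph_source _, fun _ _ => rfl⟩
  have h2 := (hopen.isOpenEmbedding_subtypeVal).isLocalHomeomorph
  rw [isLocalHomeomorph_iff_isLocalHomeomorphOn_univ] at h2 ⊢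
  exact h1.comp h2 (fun y _ => y.2)

theorem aux_limit (f : ℂ → ℂ) (hf : Differentiable ℂ f) (c : ℝ → ℂ) (hc : Continuous c) (t : ℝ)
    (ht : 0 < t) (Γ : ℝ → ℂ) (hΓ : ContinuousOn Γ (Ico 0 t)) (hl : EqOn (f ∘ Γ) c (Ico 0 t))
    (has : ¬ AsymptoticValue f (c t)) (hcr : ∀ w, f w = c t → deriv f w ≠ 0) :
    ∃ w, deriv f w ≠ 0 ∧ Tendsto Γ (𝓝[<] t) (𝓝 w) := by
  have hIco : Ico 0 t ∈ 𝓝[<] t := mem_of_superset (Ioo_mem_nhdsLT ht) Ioo_subset_Ico_self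
  have hfΓ : Tendsto (f ∘ Γ) (𝓝[<] t) (𝓝 (c t)) :=
    (hc.continuousWithinAt.tendsto).congr' (eventually_of_mem hIco fun s hs => (hl hs).symm)
  by_cases hinf : Tendsto (fun s => ‖Γ s‖) (𝓝[<] t) atTop
  · exfalso
    apply has
    let τ : ℝ → ℝ := fun s => t * (|s| / (1 + |s|))
    have hpos : ∀ s : ℝ, 0 < 1 + |s| := fun s => by positivity
    have hτc : Continuous τ := by
      refine continuous_const.mul (continuous_abs.div (by fun_prop) fun s => (hpos s).ne')
    have hτ : ∀ s, τ s ∈ Ico 0 t := by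
      intro s
      refine ⟨by positivity, ?_⟩
      have : |s| / (1 + |s|) < 1 := by rw [div_lt_one (hpos s)]; linarith
      calc τ s < t * 1 := by exact (mul_lt_mul_iff_right₀ ht).2 this
        _ = t := mul_one t
    have hτl : Tendsto τ atTop (𝓝[<] t) := by
      rw [tendsto_nhdsWithin_iff]
      refine ⟨?_, Eventually.of_forall fun s => (hτ s).2⟩
      have h1 : Tendsto (fun s : ℝ => t * (1 - (1 + s)⁻¹)) atTop (𝓝 (t * (1 - 0))) := by
        refine tendsto_const_nhds.mul (tendsto_const_nhds.sub ?_)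
        exact tendsto_inv_atTop_zero.comp (tendsto_atTop_add_const_left _ _ tendsto_id)
      simp only [sub_zero, mul_one] at h1
      refine h1.congr' ?_
      filter_upwards [eventually_ge_atTop 0] with s hs
      simp only [τ, abs_of_nonneg hs]
      have : (1 + s) ≠ 0 := by positivity
      field_simp
      ring
    exact ⟨Γ ∘ τ, hΓ.comp_continuous hτc hτ, hinf.comp hτl, hfΓ.comp hτl⟩
  · -- cluster point
    obtain ⟨w, hw⟩ : ∃ w, MapClusterPt w (𝓝[<] t) Γ := by
      rw [Filter.tendsto_atTop] at hinf
      push Not at hinf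
      obtain ⟨R, hR⟩ := hinf
      obtain ⟨w, -, hw⟩ := (isCompact_closedBall (0:ℂ) R).exists_mapClusterPt_of_frequently
        (hR.mono fun s hs => by
          simpa using hs.le)
      exact ⟨w, hw⟩
    have hfw : f w = c t := by
      have h1 : MapClusterPt (f w) (𝓝[<] t) (f ∘ Γ) := hw.continuousAt_comp hf.continuous.continuousAt
      have := h1.clusterPt.mono (hfΓ)
      exact eq_of_nhds_neBot this
    refine ⟨w, hcr w hfw, ?_⟩
    obtain ⟨q, hq, hpq⟩ := aux_localHomeo f hf ⟨w, hcr w hfw⟩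
    have hev : ∀ᶠ z in 𝓝[≠] w, f z ≠ c t := by
      rw [← hfw]
      exact (hf w).hasDerivAt.eventually_ne (hcr w hfw)
    obtain ⟨ε₀, hε₀, hne⟩ := Metric.eventually_nhds_iff.1 (eventually_nhdsWithin_iff.1 hev)
    rw [(nhds_basis_ball (x := w)).tendsto_right_iff]
    intro ε' hε'
    obtain ⟨ε, hε, hεε', hεε₀⟩ : ∃ ε > 0, ε ≤ ε' ∧ ε < ε₀ :=
      ⟨min ε' (ε₀/2), by positivity, min_le_left _ _, (min_le_right _ _).trans_lt (by linarith)⟩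
    have hK : IsCompact (f '' sphere w ε) := (isCompact_sphere w ε).image hf.continuous
    have hnot : c t ∉ f '' sphere w ε := by
      rintro ⟨z, hz, hzt⟩
      have hz' : dist z w = ε := hz
      refine hne (by rw [hz']; exact hεε₀) ?_ hzt
      rintro rfl
      simp at hz'
      exact hε.ne hz'
    have hev2 : ∀ᶠ s in 𝓝[<] t, c s ∉ f '' sphere w ε :=
      (hc.continuousWithinAt.tendsto).eventually (hK.isClosed.isOpen_compl.mem_nhds hnot)
    obtain ⟨s₀, hs₀, hs₀'⟩ := mem_nhdsLT_iff_exists_Ioo_subset.1 (hev2.and hIco)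
    have hsph : ∀ s ∈ Ioo s₀ t, Γ s ∉ sphere w ε := by
      intro s hs h
      exact (hs₀' hs).1 ⟨Γ s, h, hl (hs₀' hs).2⟩
    have hIoo : Ioo s₀ t ∈ 𝓝[<] t := Ioo_mem_nhdsLT hs₀
    obtain ⟨s₁, hs₁, hs₁b⟩ : ∃ s ∈ Ioo s₀ t, Γ s ∈ ball w ε := by
      have := (mapClusterPt_iff_frequently.1 hw (ball w ε) (ball_mem_nhds w hε)).and_eventually hIoo
      obtain ⟨s, h1, h2⟩ := this.exists
      exact ⟨s, h2, h1⟩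
    have hpre : IsPreconnected (Γ '' Ioo s₀ t) :=
      isPreconnected_Ioo.image _ (hΓ.mono fun s hs => (hs₀' hs).2)
    have hsub : Γ '' Ioo s₀ t ⊆ ball w ε := by
      refine IsPreconnected.subset_left_of_subset_union isOpen_ball
        (isClosed_closedBall (x := w) (ε := ε)).isOpen_compl ?_ ?_ ⟨Γ s₁, ⟨s₁, hs₁, rfl⟩, hs₁b⟩ hpre
      · exact disjoint_compl_right.mono_left ball_subset_closedBall
      · rintro _ ⟨s, hs, rfl⟩
        have := hsph s hs
        simp only [mem_sphere, mem_union, mem_ball, mem_compl_iff, mem_closedBall, not_le] at this ⊢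
        exact lt_or_gt_of_ne this
    filter_upwards [hIoo] with s hs
    exact ball_subset_ball hεε' (hsub ⟨s, hs, rfl⟩)

theorem aux_conclude (f : ℂ → ℂ) (hf : Differentiable ℂ f)
    (X : Set ℂ) (hXo : IsOpen X) (hXc : IsConnected X)
    (a : ℂ) (haX : a ∈ X)
    (hnocrit : ∀ v ∈ X \ {a}, ¬ ∃ c : ℂ, deriv f c = 0 ∧ f c = v)
    (hnoasym : ∀ v ∈ X \ {a}, ¬ AsymptoticValue f v)
    (y₀ : ℂ) (hy₀ : f y₀ = a) (hreg : deriv f y₀ ≠ 0)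
    (Y : Set ℂ) (hY : Y = connectedComponentIn (f ⁻¹' X) y₀)
    (φ ψ : ℂ → ℂ) (hφc : ContinuousOn φ X) (hφm : MapsTo φ X (ball 0 1))
    (hψc : ContinuousOn ψ (ball 0 1)) (hψm : MapsTo ψ (ball 0 1) X)
    (hψφ : ∀ x ∈ X, ψ (φ x) = x) (hφψ : ∀ z ∈ ball (0:ℂ) 1, φ (ψ z) = z) (hφa : φ a = 0) :
    BijOn f Y X ∧ ∀ y ∈ Y, f y = a → y = y₀ := by
  have hψ0 : ψ 0 = a := by rw [← hφa, hψφ a haX]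
  let E := {y : ℂ // deriv f y ≠ 0}
  let p : E → ℂ := fun y => f y
  have hp : IsLocalHomeomorph p := aux_localHomeo f hf
  let D := {z : ℂ // z ∈ ball (0:ℂ) 1}
  have hmem : ∀ (s : ℝ) (z : D), 0 ≤ s → s ≤ 1 → (s : ℂ) * z ∈ ball (0:ℂ) 1 := by
    intro s z h0 h1
    have hz := z.2
    rw [mem_ball_zero_iff] at hz ⊢
    rw [norm_mul, Complex.norm_real, Real.norm_of_nonneg h0]
    nlinarith [norm_nonneg (z : ℂ)]
  -- paths
  have hlift : ∀ z : D, ∃ Γ : ℝ → E, ContinuousOn Γ (Icc 0 1) ∧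
      (∀ s ∈ Icc (0:ℝ) 1, f (Γ s) = ψ (s * z)) ∧ Γ 0 = ⟨y₀, hreg⟩ := by
    intro z
    by_cases hz : (z : ℂ) = 0
    · refine ⟨fun _ => ⟨y₀, hreg⟩, continuousOn_const, ?_, rfl⟩
      intro s _
      simp [hz, hψ0, hy₀]
    let cl : ℝ → ℝ := fun s => max 0 (min s 1)
    have hcl0 : ∀ s, 0 ≤ cl s := fun s => le_max_left _ _
    have hcl1 : ∀ s, cl s ≤ 1 := fun s => max_le zero_le_one (min_le_right _ _)
    have hcl : ∀ s ∈ Icc (0:ℝ) 1, cl s = s := by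
      intro s hs
      simp [cl, hs.1, hs.2]
    have hclc : Continuous cl := by fun_prop
    let c : ℝ → ℂ := fun s => ψ (cl s * z)
    have hc : Continuous c := by
      refine hψc.comp_continuous ?_ fun s => hmem _ z (hcl0 s) (hcl1 s)
      exact (Complex.continuous_ofReal.comp hclc).mul continuous_const
    obtain ⟨Γ, h1, h2, h3⟩ := aux_lift_path hp c hc ⟨y₀, hreg⟩ (by simp [p, c, cl, hψ0, hy₀]) (by
      intro t ht Γ hΓ hl
      have htI : t ∈ Icc (0:ℝ) 1 := ⟨ht.1.le, ht.2⟩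
      have hv : c t ∈ X \ {a} := by
        refine ⟨hψm (hmem _ z (hcl0 t) (hcl1 t)), ?_⟩
        intro h
        have h' : ψ (cl t * z) = a := h
        have h4 := hφψ _ (hmem _ z (hcl0 t) (hcl1 t))
        rw [h', hφa, hcl t htI] at h4
        have := mul_eq_zero.1 h4.symm
        rcases this with h5 | h5
        · exact ht.1.ne' (by exact_mod_cast h5)
        · exact hz h5
      obtain ⟨w, hw, hlim⟩ := aux_limit f hf c hc t ht.1 (fun s => (Γ s : ℂ))
        (continuous_subtype_val.comp_continuousOn hΓ) hl (hnoasym _ hv)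
        (fun w hw hd => hnocrit _ hv ⟨w, hd, hw⟩)
      exact ⟨⟨w, hw⟩, tendsto_subtype_rng.2 hlim⟩)
    refine ⟨Γ, h1, ?_, h3⟩
    intro s hs
    have := h2 hs
    simp only [comp_apply, p, c, hcl s hs] at this
    exact this
  choose G hGc hGl hG0 using hlift
  let F : C(unitInterval × D, ℂ) := ⟨fun x => ψ (((x.1 : ℝ) : ℂ) * x.2), by
    refine hψc.comp_continuous ((Complex.continuous_ofReal.comp (continuous_subtype_val.comp continuous_fst)).mul (continuous_subtype_val.comp continuous_snd)) fun x => hmem _ _ x.1.2.1 x.1.2.2⟩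
  have hcont := hp.continuous_lift (T2Space.isSeparatedMap p) F
    (g := fun x => G x.2 x.1) (by
      ext x
      exact hGl x.2 x.1 x.1.2) (by
      simp only [Set.Icc.coe_zero, hG0]
      exact continuous_const) (by
      intro z
      exact (hGc z).comp_continuous continuous_subtype_val fun s => s.2)
  let S : D → E := fun z => G z 1
  have hSc : Continuous S := by
    have := hcont.comp (Continuous.prodMk_right (1 : unitInterval))
    simpa [comp_def, S] using this
  have hSl : ∀ z : D, f (S z) = ψ z := by
    intro z
    simpa using hGl z 1 ⟨zero_le_one, le_rfl⟩
  let s : X → ℂ := fun x => S ⟨φ x, hφm x.2⟩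
  have hsc : Continuous s := by
    refine continuous_subtype_val.comp (hSc.comp ?_)
    exact Continuous.subtype_mk (continuousOn_iff_continuous_domRestrict.1 hφc) _
  have hsl : ∀ x : X, f (s x) = x := fun x => (hSl _).trans (hψφ x x.2)
  have hsE : ∀ x : X, deriv f (s x) ≠ 0 := fun x => (S _).2
  have hsa : s ⟨a, haX⟩ = y₀ := by
    have h1 := hGl ⟨φ a, hφm haX⟩
    have : EqOn (G ⟨φ a, hφm haX⟩) (fun _ => ⟨y₀, hreg⟩) (Icc 0 1) := by
      refine (T2Space.isSeparatedMap p).eqOn_of_comp_eqOn hp.isLocallyInjective isPreconnected_Icc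
        (hGc _) continuousOn_const ?_ (left_mem_Icc.2 zero_le_one) (hG0 _)
      intro u hu
      simp only [comp_apply, p]
      rw [h1 u hu]
      change ψ ((u : ℂ) * φ a) = f y₀
      rw [hφa, mul_zero, hψ0, hy₀]
    have := this (right_mem_Icc.2 zero_le_one)
    exact congrArg Subtype.val this
  have hopen : IsOpen (f ⁻¹' X) := hXo.preimage hf.continuous
  -- the retraction y ↦ s (f y)
  let r : (f ⁻¹' X : Set ℂ) → ℂ := fun y => s ⟨f y, y.2⟩
  have hrc : Continuous r :=
    hsc.comp (Continuous.subtype_mk (hf.continuous.comp continuous_subtype_val) _)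
  let V : Set (f ⁻¹' X : Set ℂ) := {y | r y = y}
  have hVclosed : IsClosed V := isClosed_eq hrc continuous_subtype_val
  have hVopen : IsOpen V := by
    rw [isOpen_iff_mem_nhds]
    rintro y (hy : r y = y)
    have hyE : deriv f y ≠ 0 := by rw [← hy]; exact hsE _
    have hs : HasStrictDerivAt f (deriv f y) y :=
      (hf.contDiff (n := 1)).contDiffAt.hasStrictDerivAt (by simp)
    obtain ⟨N, hN, hinj⟩ : ∃ N ∈ 𝓝 (y : ℂ), InjOn f N := by
      refine ⟨((hs.hasStrictFDerivAt_equiv hyE).toOpenPartialHomeomorph f).source,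
        ((hs.hasStrictFDerivAt_equiv hyE).toOpenPartialHomeomorph f).open_source.mem_nhds
          (HasStrictFDerivAt.mem_toOpenPartialHomeomorph_source _), ?_⟩
      exact ((hs.hasStrictFDerivAt_equiv hyE).toOpenPartialHomeomorph f).injOn
    have h1 : ∀ᶠ z in 𝓝 y, r z ∈ N := hrc.continuousAt.eventually (by rw [hy]; exact hN)
    have h2 : ∀ᶠ z : (f ⁻¹' X : Set ℂ) in 𝓝 y, (z : ℂ) ∈ N :=
      continuous_subtype_val.continuousAt.eventually hN
    filter_upwards [h1, h2] with z hz1 hz2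
    exact hinj hz1 hz2 (hsl _)
  have hy₀X : y₀ ∈ f ⁻¹' X := by simpa [hy₀] using haX
  have hYsub : Y ⊆ f ⁻¹' X := hY ▸ connectedComponentIn_subset _ _
  have hYV : ∀ y, ∀ hy : y ∈ Y, r ⟨y, hYsub hy⟩ = y := by
    intro y hy
    have hcl : IsClopen V := ⟨hVclosed, hVopen⟩
    have hmemV : (⟨y₀, hy₀X⟩ : (f ⁻¹' X : Set ℂ)) ∈ V := by
      change s ⟨f y₀, _⟩ = y₀
      convert hsa
    have hsub := hcl.connectedComponent_subset hmemV
    rw [hY, connectedComponentIn_eq_image hy₀X] at hy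
    obtain ⟨z, hz, rfl⟩ := hy
    exact hsub hz
  have hsY : ∀ x : X, s x ∈ Y := by
    intro x
    rw [hY]
    have : ConnectedSpace X := isConnected_iff_connectedSpace.1 hXc
    have hpre : IsPreconnected (range s) := isPreconnected_range hsc
    refine hpre.subset_connectedComponentIn ⟨⟨a, haX⟩, hsa⟩ ?_ ⟨x, rfl⟩
    rintro _ ⟨x', rfl⟩
    change f (s x') ∈ X
    rw [hsl]; exact x'.2
  refine ⟨⟨hYsub, ?_, ?_⟩, ?_⟩
  · intro y hy y' hy' h
    rw [← hYV y hy, ← hYV y' hy']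
    simp only [r, h]
  · intro x hx
    exact ⟨s ⟨x, hx⟩, hsY _, hsl _⟩
  · intro y hy h
    rw [← hYV y hy, ← hsa]
    simp only [r, h]


/-- Disc automorphism. -/
noncomputable def auxMob (w z : ℂ) : ℂ := (z - w) / (1 - (starRingEnd ℂ) w * z)

theorem auxMob_den {w z : ℂ} (hw : ‖w‖ < 1) (hz : ‖z‖ < 1) : 1 - (starRingEnd ℂ) w * z ≠ 0 := by
  intro h
  have h1 : (starRingEnd ℂ) w * z = 1 := (sub_eq_zero.1 h).symm
  have h2 : ‖w‖ * ‖z‖ = 1 := by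
    rw [← Complex.norm_conj w, ← norm_mul, h1, norm_one]
  nlinarith [norm_nonneg w, norm_nonneg z]

theorem auxMob_norm {w z : ℂ} (hw : ‖w‖ < 1) (hz : ‖z‖ < 1) : ‖auxMob w z‖ < 1 := by
  unfold auxMob
  have hd := auxMob_den hw hz
  rw [norm_div, div_lt_one (norm_pos_iff.2 hd)]
  rw [← sq_lt_sq₀ (norm_nonneg _) (norm_nonneg _), ← Complex.normSq_eq_norm_sq,
    ← Complex.normSq_eq_norm_sq]
  have h1 : Complex.normSq w < 1 := by
    rw [Complex.normSq_eq_norm_sq]; nlinarith [norm_nonneg w]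
  have h2 : Complex.normSq z < 1 := by
    rw [Complex.normSq_eq_norm_sq]; nlinarith [norm_nonneg z]
  simp only [Complex.normSq_apply, Complex.sub_re, Complex.sub_im, Complex.mul_re, Complex.mul_im,
    Complex.one_re, Complex.one_im, Complex.conj_re, Complex.conj_im] at *
  nlinarith [mul_pos (sub_pos.2 h1) (sub_pos.2 h2)]

theorem auxMob_inj {w z z' : ℂ} (hw : ‖w‖ < 1) (hz : ‖z‖ < 1) (hz' : ‖z'‖ < 1)
    (h : auxMob w z = auxMob w z') : z = z' := by
  unfold auxMob at h
  rw [div_eq_div_iff (auxMob_den hw hz) (auxMob_den hw hz')] at h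
  have h3 : (z - z') * (1 - (starRingEnd ℂ) w * w) = 0 := by linear_combination h
  rcases mul_eq_zero.1 h3 with h4 | h4
  · exact sub_eq_zero.1 h4
  · exact absurd h4 (auxMob_den hw hw)

theorem auxMob_deriv {w z : ℂ} (hw : ‖w‖ < 1) (hz : ‖z‖ < 1) :
    HasDerivAt (auxMob w) ((1 - (starRingEnd ℂ) w * w) / (1 - (starRingEnd ℂ) w * z) ^ 2) z := by
  have h1 : HasDerivAt (fun z => z - w) 1 z := (hasDerivAt_id z).sub_const w
  have h2 : HasDerivAt (fun z => 1 - (starRingEnd ℂ) w * z) (-((starRingEnd ℂ) w * 1)) z :=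
    ((hasDerivAt_id z).const_mul _).const_sub 1
  have := h1.fun_div h2 (auxMob_den hw hz)
  have h3 : (1 - (starRingEnd ℂ) w * w) =
      (1 * (1 - (starRingEnd ℂ) w * z) - (z - w) * (-((starRingEnd ℂ) w * 1))) := by ring
  rw [h3]
  exact this

/-- family for Riemann mapping -/
def AuxFam (X : Set ℂ) (a : ℂ) (φ : ℂ → ℂ) : Prop :=
  DifferentiableOn ℂ φ X ∧ InjOn φ X ∧ MapsTo φ X (ball 0 1) ∧ φ a = 0

theorem aux_sqrt_deriv {g h : ℂ → ℂ} {h' x : ℂ} (hg : ContinuousAt g x) (hgh : ∀ z, g z ^ 2 = h z)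
    (hh : HasDerivAt h h' x) (h0 : g x ≠ 0) : HasDerivAt g (h' / (2 * g x)) x := by
  rw [hasDerivAt_iff_tendsto_slope] at hh ⊢
  have h1 : Tendsto (fun z => g z + g x) (𝓝[≠] x) (𝓝 (2 * g x)) := by
    rw [two_mul]
    exact (hg.tendsto.mono_left nhdsWithin_le_nhds).add_const _
  have h2 := hh.div h1 (by simpa using h0)
  refine h2.congr' ?_
  filter_upwards [h1.eventually_ne (by simpa using h0 : 2 * g x ≠ 0), self_mem_nhdsWithin] with z hz hzx
  have : z - x ≠ 0 := sub_ne_zero.2 hzx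
  simp only [Pi.div_apply, slope_def_field, ← hgh]
  field_simp
  ring

theorem aux_koebe {X : Set ℂ} (hXo : IsOpen X) (hXsc : IsSimplyConnected X) {a : ℂ} (haX : a ∈ X)
    {φ : ℂ → ℂ} (hφ : AuxFam X a φ) (hd : deriv φ a ≠ 0) {w : ℂ} (hw : ‖w‖ < 1)
    (hwX : w ∉ φ '' X) : ∃ φ₁, AuxFam X a φ₁ ∧ ‖deriv φ a‖ < ‖deriv φ₁ a‖ := by
  obtain ⟨hφd, hφi, hφm, hφa⟩ := hφ
  have hn : ∀ x ∈ X, ‖φ x‖ < 1 := fun x hx => by simpa using hφm hx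
  have hφD : ∀ x ∈ X, HasDerivAt φ (deriv φ x) x := fun x hx =>
    (hφd.differentiableAt (hXo.mem_nhds hx)).hasDerivAt
  let h : ℂ → ℂ := fun x => auxMob w (φ x)
  have hhD : ∀ x ∈ X, HasDerivAt h
      ((1 - (starRingEnd ℂ) w * w) / (1 - (starRingEnd ℂ) w * φ x) ^ 2 * deriv φ x) x :=
    fun x hx => (auxMob_deriv hw (hn x hx)).comp x (hφD x hx)
  have hh0 : ∀ x ∈ X, h x ≠ 0 := by
    intro x hx h0
    rcases div_eq_zero_iff.1 h0 with h1 | h1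
    · exact hwX ⟨x, hx, sub_eq_zero.1 h1⟩
    · exact auxMob_den hw (hn x hx) h1
  have hh1 : ∀ x ∈ X, ‖h x‖ < 1 := fun x hx => auxMob_norm hw (hn x hx)
  obtain ⟨g, hgc, hg⟩ := Complex.exists_continuousOn_pow_eq hXsc hXo (g := h)
    (fun x hx => (hhD x hx).continuousAt.continuousWithinAt)
    (by rintro ⟨x, hx, h0⟩; exact hh0 x hx h0) two_ne_zero
  have hg0 : ∀ x ∈ X, g x ≠ 0 := by
    intro x hx h0
    apply hh0 x hx
    rw [← hg, h0]; simp
  have hg1 : ∀ x ∈ X, ‖g x‖ < 1 := by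
    intro x hx
    have := hh1 x hx
    rw [← hg, norm_pow] at this
    nlinarith [norm_nonneg (g x)]
  have hgD := fun x hx => aux_sqrt_deriv (hgc.continuousAt (hXo.mem_nhds hx)) hg (hhD x hx) (hg0 x hx)
  set b := g a with hb
  have hb1 : ‖b‖ < 1 := hg1 a haX
  have hb0 : b ≠ 0 := hg0 a haX
  have hbw : b ^ 2 = -w := by
    rw [hb, hg]; simp [h, auxMob, hφa]
  have hD := fun x hx => (auxMob_deriv hb1 (hg1 x hx)).comp x (hgD x hx)
  refine ⟨fun x => auxMob b (g x), ⟨?_, ?_, ?_, ?_⟩, ?_⟩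
  · exact fun x hx => (hD x hx).differentiableAt.differentiableWithinAt
  · intro x hx y hy hxy
    have h1 := auxMob_inj hb1 (hg1 x hx) (hg1 y hy) hxy
    have h2 : h x = h y := by rw [← hg, ← hg, h1]
    exact hφi hx hy (auxMob_inj hw (hn x hx) (hn y hy) h2)
  · intro x hx
    simpa using auxMob_norm hb1 (hg1 x hx)
  · simp [auxMob, ← hb]
  · have h1 : deriv (fun x => auxMob b (g x)) a = _ := (hD a haX).deriv
    rw [h1, hφa, ← hb]
    have e1 : (1 : ℂ) - (starRingEnd ℂ) b * b = ((1 - ‖b‖ ^ 2 : ℝ) : ℂ) := by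
      rw [mul_comm, Complex.mul_conj, Complex.normSq_eq_norm_sq]; push_cast; ring
    have e2 : (1 : ℂ) - (starRingEnd ℂ) w * w = ((1 - ‖b‖ ^ 4 : ℝ) : ℂ) := by
      have : ‖w‖ = ‖b‖ ^ 2 := by rw [← norm_pow, hbw, norm_neg]
      rw [mul_comm, Complex.mul_conj, Complex.normSq_eq_norm_sq, this]; push_cast; ring
    rw [e1, e2]
    have hbp : 0 < ‖b‖ := norm_pos_iff.2 hb0
    have hq : 0 < 1 - ‖b‖ ^ 2 := by nlinarith
    have hq4 : 0 < 1 - ‖b‖ ^ 4 := by nlinarith [sq_nonneg (‖b‖^2)]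
    have hdp : 0 < ‖deriv φ a‖ := norm_pos_iff.2 hd
    simp only [mul_zero, sub_zero, one_pow, div_one, norm_mul, norm_div, norm_pow,
      Complex.norm_real, Real.norm_of_nonneg hq.le, Real.norm_of_nonneg hq4.le, Complex.norm_ofNat]
    have : (1 - ‖b‖ ^ 2) / (1 - ‖b‖ ^ 2) ^ 2 * ((1 - ‖b‖ ^ 4) * ‖deriv φ a‖ / (2 * ‖b‖))
        = ‖deriv φ a‖ * ((1 + ‖b‖ ^ 2) / (2 * ‖b‖)) := by
      field_simp
      ring
    rw [this]
    have h5 : 1 < (1 + ‖b‖ ^ 2) / (2 * ‖b‖) := by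
      rw [one_lt_div (by positivity)]
      nlinarith [sq_pos_of_pos (sub_pos.2 hb1)]
    nlinarith

theorem aux_tlu {X : Set ℂ} (hXo : IsOpen X) {F : ℕ → ℂ → ℂ} (hd : ∀ n, DifferentiableOn ℂ (F n) X)
    (hm : ∀ n, MapsTo (F n) X (ball 0 1)) {U : Filter ℕ} [U.NeBot] {φ : ℂ → ℂ}
    (hφ : ∀ x ∈ X, Tendsto (fun n => F n x) U (𝓝 (φ x))) : TendstoLocallyUniformlyOn F φ U X := by
  rw [Metric.tendstoLocallyUniformlyOn_iff]
  intro ε hε x hx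
  obtain ⟨R, hR, hRX⟩ := Metric.isOpen_iff.1 hXo x hx
  have hlip : ∀ n, ∀ y ∈ ball x R, dist (F n y) (F n x) ≤ 2 / R * dist y x := by
    intro n y hy
    refine Complex.dist_le_div_mul_dist_of_mapsTo_ball ((hd n).mono hRX) ?_ hy
    intro z hz
    have h1 := hm n (hRX hz)
    have h2 := hm n hx
    rw [mem_ball_zero_iff] at h1 h2
    rw [mem_closedBall, dist_eq_norm]
    linarith [norm_sub_le (F n z) (F n x)]
  have hlip' : ∀ y ∈ ball x R, dist (φ y) (φ x) ≤ 2 / R * dist y x := by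
    intro y hy
    exact le_of_tendsto ((hφ y (hRX hy)).dist (hφ x hx)) (Eventually.of_forall fun n => hlip n y hy)
  let δ := min R (ε * R / 8)
  have hδ : 0 < δ := by positivity
  refine ⟨ball x δ, mem_nhdsWithin_of_mem_nhds (ball_mem_nhds x hδ), ?_⟩
  have hev := Metric.tendsto_nhds.1 (hφ x hx) (ε / 4) (by positivity)
  filter_upwards [hev] with n hn y hy
  have hyR : y ∈ ball x R := ball_subset_ball (min_le_left _ _) hy
  have hyd : 2 / R * dist y x ≤ ε / 4 := by
    have h1 : dist y x ≤ ε * R / 8 := (mem_ball.1 hy).le.trans (min_le_right _ _)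
    calc 2 / R * dist y x ≤ 2 / R * (ε * R / 8) := by gcongr
      _ = ε / 4 := by field_simp; ring
  have h1 := hlip n y hyR
  have h2 := hlip' y hyR
  calc dist (φ y) (F n y) ≤ dist (φ y) (φ x) + dist (φ x) (F n x) + dist (F n x) (F n y) :=
        dist_triangle4 _ _ _ _
    _ < ε := by rw [dist_comm (φ x), dist_comm (F n x) (F n y)]; linarith

theorem aux_hurwitz {X : Set ℂ} (hXo : IsOpen X) (hXc : IsPreconnected X) {F : ℕ → ℂ → ℂ}
    (hd : ∀ n, DifferentiableOn ℂ (F n) X) (hi : ∀ n, InjOn (F n) X)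
    {U : Filter ℕ} [U.NeBot] {φ : ℂ → ℂ} (hφ : TendstoLocallyUniformlyOn F φ U X)
    {a : ℂ} (haX : a ∈ X) (hda : deriv φ a ≠ 0) : InjOn φ X := by
  have hφd : DifferentiableOn ℂ φ X := hφ.differentiableOn (Eventually.of_forall hd) hXo
  have hφa : AnalyticOnNhd ℂ φ X := hφd.analyticOnNhd hXo
  intro z1 hz1 z2 hz2 h12
  by_contra hne
  have hpt : ∀ x ∈ X, Tendsto (fun n => F n x) U (𝓝 (φ x)) := fun x hx => hφ.tendsto_at hx
  -- isolated
  have hiso : ∀ᶠ z in 𝓝[≠] z2, φ z ≠ φ z1 := by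
    rcases (hφa z2 hz2).eventually_eq_or_eventually_ne (analyticAt_const (v := φ z1)) with h | h
    · exfalso
      have h2 : EqOn φ (fun _ => φ z1) X :=
        hφa.eqOn_of_preconnected_of_eventuallyEq analyticOnNhd_const hXc hz2 h
      apply hda
      have h3 : φ =ᶠ[𝓝 a] fun _ => φ z1 := by
        filter_upwards [hXo.mem_nhds haX] with x hx using h2 hx
      rw [h3.deriv_eq]; simp
    · exact h
  have hev : ∀ᶠ z in 𝓝 z2, z ∈ X ∧ z ≠ z1 ∧ (z ≠ z2 → φ z ≠ φ z1) := by
    filter_upwards [hXo.mem_nhds hz2, isOpen_ne.mem_nhds (Ne.symm hne),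
      eventually_nhdsWithin_iff.1 hiso] with z h1 h2 h3 using ⟨h1, h2, h3⟩
  obtain ⟨r, hr, hball⟩ := Metric.nhds_basis_closedBall.eventually_iff.1 hev
  have hcbX : closedBall z2 r ⊆ X := fun z hz => (hball hz).1
  have hsph : sphere z2 r ⊆ X := sphere_subset_closedBall.trans hcbX
  have hcont : ContinuousOn (fun z => ‖φ z - φ z1‖) (sphere z2 r) :=
    ((hφd.continuousOn.mono hsph).sub continuousOn_const).norm
  have hsne : (sphere z2 r).Nonempty := NormedSpace.sphere_nonempty.2 hr.le
  obtain ⟨p, hp, hpmin⟩ := (isCompact_sphere z2 r).exists_isMinOn hsne hcont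
  set m := ‖φ p - φ z1‖ with hm
  have hm0 : 0 < m := by
    rw [hm, norm_pos_iff, sub_ne_zero]
    refine (hball (sphere_subset_closedBall hp)).2.2 ?_
    rintro rfl
    simp at hp
    exact hr.ne hp
  have hunif : TendstoUniformlyOn F φ U (sphere z2 r) :=
    (tendstoLocallyUniformlyOn_iff_forall_isCompact hXo).1 hφ _ hsph (isCompact_sphere _ _)
  have e1 := Metric.tendstoUniformlyOn_iff.1 hunif (m/4) (by positivity)
  have e2 := Metric.tendsto_nhds.1 (hpt z1 hz1) (m/4) (by positivity)
  have e3 := Metric.tendsto_nhds.1 ((hpt z2 hz2).sub (hpt z1 hz1)) (m/4) (by positivity)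
  obtain ⟨n, h1, h2, h3⟩ := (e1.and (e2.and e3)).exists
  have hnz : ∀ z ∈ closedBall z2 r, F n z - F n z1 ≠ 0 := by
    intro z hz h0
    exact (hball hz).2.1 (hi n (hball hz).1 hz1 (sub_eq_zero.1 h0))
  have hdc : DiffContOnCl ℂ (fun z => (F n z - F n z1)⁻¹) (ball z2 r) := by
    apply DifferentiableOn.diffContOnCl
    rw [closure_ball _ hr.ne']
    exact (((hd n).mono hcbX).sub_const _).inv hnz
  have hmax := Complex.norm_le_of_forall_mem_frontier_norm_le isBounded_ball hdc (C := (m/2)⁻¹)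
    (by
      intro z hz
      rw [frontier_ball _ hr.ne'] at hz
      rw [norm_inv]
      apply inv_anti₀ (by positivity)
      have h4 : m ≤ ‖φ z - φ z1‖ := hpmin hz
      have h5 := h1 z hz
      rw [dist_eq_norm] at h5 h2
      have h6 : ‖φ z - φ z1‖ ≤ ‖φ z - F n z‖ + ‖F n z - F n z1‖ + ‖F n z1 - φ z1‖ := by
        calc ‖φ z - φ z1‖ = ‖(φ z - F n z) + (F n z - F n z1) + (F n z1 - φ z1)‖ := by
              congr 1; ring
          _ ≤ _ := norm_add₃_le
      linarith) (subset_closure (mem_ball_self hr))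
  rw [norm_inv] at hmax
  have h7 : m / 2 ≤ ‖F n z2 - F n z1‖ :=
    (inv_le_inv₀ (norm_pos_iff.2 (hnz z2 (mem_closedBall_self hr.le))) (by positivity)).1 hmax
  rw [h12, sub_self, dist_zero_right] at h3
  linarith

theorem aux_riemann {X : Set ℂ} (hXb : Bornology.IsBounded X) (hXo : IsOpen X)
    (hXc : IsPreconnected X) (hXsc : IsSimplyConnected X) {a : ℂ} (haX : a ∈ X) :
    ∃ φ ψ : ℂ → ℂ, ContinuousOn φ X ∧ MapsTo φ X (ball 0 1) ∧ ContinuousOn ψ (ball 0 1) ∧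
      MapsTo ψ (ball 0 1) X ∧ (∀ x ∈ X, ψ (φ x) = x) ∧ (∀ z ∈ ball 0 1, φ (ψ z) = z) ∧
      φ a = 0 := by
  obtain ⟨R, hR, hRX⟩ := Metric.isOpen_iff.1 hXo a haX
  set S : Set ℝ := {d | ∃ φ, AuxFam X a φ ∧ d = ‖deriv φ a‖} with hS
  have hbdd : BddAbove S := by
    refine ⟨1 / R, ?_⟩
    rintro d ⟨φ, hφ, rfl⟩
    refine Complex.norm_deriv_le_div_of_mapsTo_ball (hφ.1.mono hRX) ?_ hR
    rw [hφ.2.2.2]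
    exact fun z hz => ball_subset_closedBall (hφ.2.2.1 (hRX hz))
  obtain ⟨M, hM0, hM⟩ := hXb.subset_ball_lt 0 a
  have hMc : (M : ℂ) ≠ 0 := by exact_mod_cast hM0.ne'
  have h0 : 1 / M ∈ S := by
    refine ⟨fun z => (z - a) / M, ⟨?_, ?_, ?_, ?_⟩, ?_⟩
    · fun_prop
    · intro x _ y _ h
      simpa [hMc] using h
    · intro x hx
      have := hM hx
      rw [mem_ball, dist_eq_norm] at this
      rw [mem_ball_zero_iff, norm_div, Complex.norm_real, Real.norm_of_nonneg hM0.le,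
        div_lt_one hM0]
      exact this
    · simp
    · have : HasDerivAt (fun z : ℂ => (z - a) / M) (1 / M) a :=
        ((hasDerivAt_id a).sub_const a).div_const _
      rw [this.deriv, norm_div, Complex.norm_real, Real.norm_of_nonneg hM0.le, norm_one]
  have hSne : S.Nonempty := ⟨_, h0⟩
  have hpos : 0 < sSup S := lt_of_lt_of_le (by positivity) (le_csSup hbdd h0)
  obtain ⟨u, -, hu, huS⟩ := exists_seq_tendsto_sSup hSne hbdd
  choose F hF hFu using huS
  let U : Ultrafilter ℕ := hyperfilter ℕ
  have hUle : (U : Filter ℕ) ≤ atTop := by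
    rw [← Nat.cofinite_eq_atTop]; exact hyperfilter_le_cofinite
  have hex : ∀ x, ∃ l, x ∈ X → l ∈ closedBall (0:ℂ) 1 ∧ Tendsto (fun n => F n x) U (𝓝 l) := by
    intro x
    by_cases hx : x ∈ X
    · obtain ⟨l, hl, hl'⟩ := (isCompact_closedBall (0:ℂ) 1).ultrafilter_le_nhds
        (U.map (fun n => F n x)) (by
          rw [le_principal_iff]
          exact Filter.mem_map.2 (Filter.univ_mem' fun n =>
            ball_subset_closedBall ((hF n).2.2.1 hx)))
      exact ⟨l, fun _ => ⟨hl, hl'⟩⟩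
    · exact ⟨0, fun h => absurd h hx⟩
  choose φ hφ using hex
  have htl : TendstoLocallyUniformlyOn F φ U X :=
    aux_tlu hXo (fun n => (hF n).1) (fun n => (hF n).2.2.1) (fun x hx => (hφ x hx).2)
  have hφd : DifferentiableOn ℂ φ X :=
    htl.differentiableOn (Eventually.of_forall fun n => (hF n).1) hXo
  have hder := (htl.deriv (Eventually.of_forall fun n => (hF n).1) hXo).tendsto_at haX
  have hnd : ‖deriv φ a‖ = sSup S := by
    refine tendsto_nhds_unique hder.norm ?_
    have := hu.mono_left hUle
    exact this.congr fun n => hFu n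
  have hda : deriv φ a ≠ 0 := by
    rw [← norm_pos_iff, hnd]; exact hpos
  have hinj : InjOn φ X := aux_hurwitz hXo hXc (fun n => (hF n).1) (fun n => (hF n).2.1) htl haX hda
  have hopen : ∀ s ⊆ X, IsOpen s → IsOpen (φ '' s) := by
    rcases (hφd.analyticOnNhd hXo).is_constant_or_isOpen hXc with ⟨w, hw⟩ | h
    · exfalso
      apply hda
      have h3 : φ =ᶠ[𝓝 a] fun _ => w := by
        filter_upwards [hXo.mem_nhds haX] with x hx using hw x hx
      rw [h3.deriv_eq]; simp
    · exact h
  have hmaps : MapsTo φ X (ball 0 1) := by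
    have h1 : φ '' X ⊆ closedBall 0 1 := by
      rintro _ ⟨x, hx, rfl⟩
      exact (hφ x hx).1
    have h2 : φ '' X ⊆ interior (closedBall 0 1) :=
      interior_maximal h1 (hopen X subset_rfl hXo)
    rw [interior_closedBall _ one_ne_zero] at h2
    exact fun x hx => h2 ⟨x, hx, rfl⟩
  have hφ0 : φ a = 0 := by
    refine tendsto_nhds_unique (hφ a haX).2 ?_
    exact tendsto_const_nhds.congr fun n => ((hF n).2.2.2).symm
  have hfam : AuxFam X a φ := ⟨hφd, hinj, hmaps, hφ0⟩
  have hsurj : SurjOn φ X (ball 0 1) := by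
    intro w hw
    by_contra hwX
    obtain ⟨φ₁, h1, h2⟩ := aux_koebe hXo hXsc haX hfam hda (mem_ball_zero_iff.1 hw) hwX
    have := le_csSup hbdd (⟨φ₁, h1, rfl⟩ : ‖deriv φ₁ a‖ ∈ S)
    linarith
  have hψm : MapsTo (invFunOn φ X) (ball 0 1) X := fun w hw => invFunOn_mem (hsurj hw)
  have hφψ : ∀ z ∈ ball (0:ℂ) 1, φ (invFunOn φ X z) = z := fun z hz => invFunOn_eq (hsurj hz)
  have hψφ : ∀ x ∈ X, invFunOn φ X (φ x) = x := fun x hx =>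
    hinj (hψm (hmaps hx)) hx (hφψ _ (hmaps hx))
  refine ⟨φ, invFunOn φ X, hφd.continuousOn, hmaps, ?_, hψm, hψφ, hφψ, hφ0⟩
  rw [continuousOn_open_iff isOpen_ball]
  intro t ht
  have : ball 0 1 ∩ invFunOn φ X ⁻¹' t = φ '' (X ∩ t) := by
    ext w
    constructor
    · rintro ⟨hw, hwt⟩
      exact ⟨invFunOn φ X w, ⟨hψm hw, hwt⟩, hφψ w hw⟩
    · rintro ⟨x, ⟨hx, hxt⟩, rfl⟩
      refine ⟨hmaps hx, ?_⟩
      rw [mem_preimage, hψφ x hx]; exact hxt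
  rw [this]
  exact hopen _ inter_subset_left (hXo.inter ht)

end AuxLemmas

/-- If `X` is a bounded simply connected domain such that `X ∖ {a}` contains no singular value
of the entire function `f`, then `f` maps the connected component `Y` of `f⁻¹(X)` containing a
regular preimage `y₀` of `a` bijectively onto `X`; in particular `y₀` is the unique preimage
of `a` in `Y`. -/
theorem component_maps_bijectively
    (f : ℂ → ℂ) (hf : Differentiable ℂ f) (hnc : ∀ c : ℂ, f ≠ fun _ => c)
    (hcrit : {c : ℂ | deriv f c = 0}.Finite)
    (hasym : {a : ℂ | AsymptoticValue f a}.Finite)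
    (X : Set ℂ) (hXb : Bornology.IsBounded X) (hXo : IsOpen X) (hXc : IsConnected X)
    (hXsc : SimplyConnectedSpace ↥X)
    (a : ℂ) (haX : a ∈ X)
    (hnocrit : ∀ v ∈ X \ {a}, ¬ ∃ c : ℂ, deriv f c = 0 ∧ f c = v)
    (hnoasym : ∀ v ∈ X \ {a}, ¬ AsymptoticValue f v)
    (y₀ : ℂ) (hy₀ : f y₀ = a) (hreg : deriv f y₀ ≠ 0)
    (Y : Set ℂ) (hY : Y = connectedComponentIn (f ⁻¹' X) y₀) :
    BijOn f Y X ∧ ∀ y ∈ Y, f y = a → y = y₀ := by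
  have hsc : IsSimplyConnected X := hXsc
  obtain ⟨φ, ψ, h1, h2, h3, h4, h5, h6, h7⟩ :=
    aux_riemann hXb hXo hXc.isPreconnected hsc haX
  exact aux_conclude f hf X hXo hXc a haX hnocrit hnoasym y₀ hy₀ hreg Y hY φ ψ h1 h2 h3 h4 h5 h6 h7
end
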